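/- arXiv:1111.4189 — 2 statements merged into one kernel-verified Lean document; each statement's English description precedes it below -/
import Mathlib

section
/- In two-color Babylon with initial position consisting of p red singleton stacks and q blue singleton stacks, where 1 ≤ p ≤ q, the second player (Bob) has a winning strategy if and only if p+q is even and p ≥ 3; equivalently, the initial position is a first-player win if and only if p+q is odd or p ≤ 2. -/
/-- A chip color: `true` = red, `false` = blue.  A stack is a nonempty list of
chips, the head of the list being the top chip; the color of a stack is the
color of its top chip.  A position is a finite multiset of stacks. -/
abbrev Stack := List Bool

abbrev Position := Multiset Stack

/-- A legal move replaces two stacks `s` and `t` that have equal length or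
equal top color by the single concatenated stack `s ++ t`. -/
def Move (P Q : Position) : Prop :=
  ∃ s t : Stack, s ≠ [] ∧ t ≠ [] ∧ s ∈ P ∧ t ∈ P.erase s ∧
    (s.length = t.length ∨ s.head? = t.head?) ∧
    Q = (s ++ t) ::ₘ (P.erase s).erase t

/-- Auxiliary predicate, with the number of stacks as fuel: the player to move
wins iff there is a legal move to a position that is not a first-player win. -/
def FirstWinAux : ℕ → Position → Prop
  | 0, _ => False
  | n + 1, P => ∃ Q, Move P Q ∧ ¬ FirstWinAux n Q

/-- The position is a first-player win: the player to move has a winning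
strategy.  Since each move decreases the number of stacks by exactly one,
`Multiset.card P` is enough fuel. -/
def FirstWin (P : Position) : Prop := FirstWinAux (Multiset.card P) P

/-- The initial position with `p` red singleton stacks and `q` blue
singleton stacks. -/
def initPos (p q : ℕ) : Position :=
  Multiset.replicate p [true] + Multiset.replicate q [false]

namespace Babylon

/-- The lengths of the stacks of color `c`. -/
def lens (c : Bool) (S : Position) : Multiset ℕ :=
  (S.filter (fun s => s.head? = some c)).map List.length

/-- The moves, in terms of the heights of the red stacks and of the blue stacks before the move,
followed by those after the move. -/
inductive Mv : Multiset ℕ → Multiset ℕ → Multiset ℕ → Multiset ℕ → Prop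
  | red (a b : ℕ) (R B : Multiset ℕ) : Mv (a ::ₘ b ::ₘ R) B ((a + b) ::ₘ R) B
  | blue (a b : ℕ) (R B : Multiset ℕ) : Mv R (a ::ₘ b ::ₘ B) R ((a + b) ::ₘ B)
  | redEat (a : ℕ) (R B : Multiset ℕ) : Mv (a ::ₘ R) (a ::ₘ B) ((a + a) ::ₘ R) B
  | blueEat (a : ℕ) (R B : Multiset ℕ) : Mv (a ::ₘ R) (a ::ₘ B) R ((a + a) ::ₘ B)

/-- With the given fuel, the player to move wins from the red heights `R` and blue heights `B`. -/
def WinAux : ℕ → Multiset ℕ → Multiset ℕ → Prop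
  | 0, _, _ => False
  | n + 1, R, B => ∃ R' B', Mv R B R' B' ∧ ¬ WinAux n R' B'

/-- The player to move wins from the red heights `R` and blue heights `B`. -/
def Win (R B : Multiset ℕ) : Prop := WinAux (R.card + B.card) R B

theorem lens_cons_self {c : Bool} {s : Stack} (h : s.head? = some c) (S : Position) :
    lens c (s ::ₘ S) = s.length ::ₘ lens c S := by
  simp [lens, h]

theorem lens_cons_not {c : Bool} {s : Stack} (h : s.head? = some (!c)) (S : Position) :
    lens c (s ::ₘ S) = lens c S := by
  simp [lens, h]

theorem lens_eq_cons {c : Bool} {S : Position} {a : ℕ} {R : Multiset ℕ}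
    (h : lens c S = a ::ₘ R) :
    ∃ s S', S = s ::ₘ S' ∧ s.head? = some c ∧ s.length = a ∧ lens c S' = R := by
  have ha : a ∈ lens c S := h ▸ Multiset.mem_cons_self a R
  simp only [lens, Multiset.mem_map, Multiset.mem_filter] at ha
  obtain ⟨s, ⟨hs, hc⟩, rfl⟩ := ha
  obtain ⟨S', rfl⟩ := Multiset.exists_cons_of_mem hs
  rw [lens_cons_self hc, Multiset.cons_inj_right] at h
  exact ⟨s, S', rfl, hc, rfl, h⟩

theorem move_iff {P Q : Position} : Move P Q ↔ ∃ s t P', s ≠ [] ∧ t ≠ [] ∧ P = s ::ₘ t ::ₘ P' ∧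
    (s.length = t.length ∨ s.head? = t.head?) ∧ Q = (s ++ t) ::ₘ P' := by
  constructor
  · rintro ⟨s, t, hs, ht, hsP, htP, hst, rfl⟩
    exact ⟨s, t, _, hs, ht, by rw [Multiset.cons_erase htP, Multiset.cons_erase hsP], hst, rfl⟩
  · rintro ⟨s, t, P', hs, ht, rfl, hst, rfl⟩
    exact ⟨s, t, hs, ht, by simp, by simp, hst, by simp⟩

theorem head?_eq_of_ne_nil {s : Stack} (h : s ≠ []) :
    s.head? = some true ∨ s.head? = some false := by
  rcases s with _ | ⟨_ | _, s⟩ <;> simp_all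

theorem head?_append_of {s t : Stack} {c : Bool} (h : s.head? = some c) :
    (s ++ t).head? = some c := by
  simp [List.head?_append, h]

theorem mv_of_move {P Q : Position} (h : Move P Q) :
    Mv (lens true P) (lens false P) (lens true Q) (lens false Q) := by
  obtain ⟨s, t, P', hs, ht, rfl, hst, rfl⟩ := move_iff.1 h
  rcases head?_eq_of_ne_nil hs with hs | hs <;> rcases head?_eq_of_ne_nil ht with ht | ht <;>
    simp only [lens_cons_self, lens_cons_not, hs, ht, head?_append_of hs, Bool.not_true,
      Bool.not_false, List.length_append] <;>
    simp only [hs, ht, Option.some.injEq, reduceCtorEq, or_false, or_true] at hst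
  · exact .red ..
  · rw [← hst]; exact .redEat ..
  · rw [hst]; exact .blueEat ..
  · exact .blue ..

theorem exists_move_of_mv {P : Position} {R B R' B' : Multiset ℕ} (h : Mv R B R' B')
    (hR : lens true P = R) (hB : lens false P = B) :
    ∃ Q, Move P Q ∧ lens true Q = R' ∧ lens false Q = B' := by
  have ne {s : Stack} {c : Bool} (h : s.head? = some c) : s ≠ [] := by rintro rfl; simp at h
  cases h with
  | red a b R _ =>
    obtain ⟨s, P, rfl, hs, rfl, h⟩ := lens_eq_cons hR
    obtain ⟨t, P, rfl, ht, rfl, h'⟩ := lens_eq_cons h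
    refine ⟨_, move_iff.2 ⟨s, t, P, ne hs, ne ht, rfl, .inr (hs.trans ht.symm), rfl⟩, ?_⟩
    simp_all [lens_cons_self, lens_cons_not, head?_append_of hs]
  | blue a b B _ =>
    obtain ⟨s, P, rfl, hs, rfl, h⟩ := lens_eq_cons hB
    obtain ⟨t, P, rfl, ht, rfl, h'⟩ := lens_eq_cons h
    refine ⟨_, move_iff.2 ⟨s, t, P, ne hs, ne ht, rfl, .inr (hs.trans ht.symm), rfl⟩, ?_⟩
    simp_all [lens_cons_self, lens_cons_not, head?_append_of hs]
  | redEat a R B =>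
    obtain ⟨s, P, rfl, hs, hsa, hR⟩ := lens_eq_cons hR
    rw [lens_cons_not (by simpa using hs)] at hB
    obtain ⟨t, P, rfl, ht, hta, hB⟩ := lens_eq_cons hB
    refine ⟨_, move_iff.2 ⟨s, t, P, ne hs, ne ht, rfl, .inl (hsa.trans hta.symm), rfl⟩, ?_⟩
    simp_all [lens_cons_self, lens_cons_not, head?_append_of hs]
  | blueEat a R B =>
    obtain ⟨s, P, rfl, hs, hsa, hR⟩ := lens_eq_cons hR
    rw [lens_cons_not (by simpa using hs)] at hB
    obtain ⟨t, P, rfl, ht, hta, hB⟩ := lens_eq_cons hB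
    refine ⟨_, move_iff.2 ⟨t, s, P, ne ht, ne hs, Multiset.cons_swap .., .inl (hta.trans hsa.symm),
      rfl⟩, ?_⟩
    simp_all [lens_cons_self, lens_cons_not, head?_append_of ht]

theorem firstWinAux_iff (n : ℕ) : ∀ P : Position,
    FirstWinAux n P ↔ WinAux n (lens true P) (lens false P) := by
  induction n with
  | zero => simp [FirstWinAux, WinAux]
  | succ n ih =>
    intro P
    constructor
    · rintro ⟨Q, hQ, h⟩
      exact ⟨_, _, mv_of_move hQ, (ih Q).not.1 h⟩
    · rintro ⟨R', B', hm, h⟩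
      obtain ⟨Q, hQ, rfl, rfl⟩ := exists_move_of_mv hm rfl rfl
      exact ⟨Q, hQ, (ih Q).not.2 h⟩

theorem lens_replicate_self (c : Bool) (n : ℕ) :
    lens c (Multiset.replicate n [c]) = Multiset.replicate n 1 := by
  induction n with
  | zero => rfl
  | succ n ih => rw [Multiset.replicate_succ, lens_cons_self rfl, ih]; rfl

theorem lens_replicate_not (c : Bool) (n : ℕ) : lens c (Multiset.replicate n [!c]) = 0 := by
  induction n with
  | zero => rfl
  | succ n ih => rw [Multiset.replicate_succ, lens_cons_not rfl, ih]

theorem lens_add (c : Bool) (S T : Position) : lens c (S + T) = lens c S + lens c T := by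
  simp [lens]

theorem firstWin_initPos_iff (p q : ℕ) :
    FirstWin (initPos p q) ↔ Win (Multiset.replicate p 1) (Multiset.replicate q 1) := by
  have hr : lens true (initPos p q) = Multiset.replicate p 1 := by
    rw [initPos, lens_add, lens_replicate_self, show [false] = [!true] from rfl,
      lens_replicate_not, add_zero]
  have hb : lens false (initPos p q) = Multiset.replicate q 1 := by
    rw [initPos, lens_add, lens_replicate_self, show [true] = [!false] from rfl,
      lens_replicate_not, zero_add]
  rw [FirstWin, firstWinAux_iff, hr, hb, Win]
  simp [initPos]

theorem Mv.card_eq {R B R' B' : Multiset ℕ} (h : Mv R B R' B') :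
    R.card + B.card = R'.card + B'.card + 1 := by
  cases h <;> simp <;> omega

theorem Mv.swap {R B R' B' : Multiset ℕ} (h : Mv R B R' B') : Mv B R B' R' := by
  cases h <;> constructor

theorem win_iff {R B : Multiset ℕ} : Win R B ↔ ∃ R' B', Mv R B R' B' ∧ ¬ Win R' B' := by
  rw [Win]
  constructor
  · intro h
    rcases hn : R.card + B.card with _ | n
    · simp [hn, WinAux] at h
    · rw [hn] at h
      obtain ⟨R', B', hm, h⟩ := h
      refine ⟨R', B', hm, ?_⟩
      rwa [Win, Nat.succ.inj (hm.card_eq.symm.trans hn)]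
  · rintro ⟨R', B', hm, h⟩
    rw [hm.card_eq]
    exact ⟨R', B', hm, h⟩

theorem Win.intro {R B R' B' : Multiset ℕ} (hm : Mv R B R' B') (h : ¬ Win R' B') : Win R B :=
  win_iff.2 ⟨R', B', hm, h⟩

theorem not_win_of {R B : Multiset ℕ} (h : ∀ R' B', Mv R B R' B' → Win R' B') : ¬ Win R B := by
  rw [win_iff]
  rintro ⟨R', B', hm, hn⟩
  exact hn (h R' B' hm)

theorem Win.swap {R B : Multiset ℕ} (h : Win R B) : Win B R := by
  induction hn : R.card + B.card generalizing R B with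
  | zero => simp [Win, hn, WinAux] at h
  | succ n ih =>
    obtain ⟨R', B', hm, h⟩ := win_iff.1 h
    refine .intro hm.swap fun h' => h (ih h' ?_)
    have := hm.card_eq
    omega

theorem win_of_red (a b : ℕ) (R : Multiset ℕ) {B : Multiset ℕ} (h : ¬ Win ((a + b) ::ₘ R) B) :
    Win (a ::ₘ b ::ₘ R) B :=
  .intro (.red ..) h

theorem win_of_blue (a b : ℕ) {R : Multiset ℕ} (B : Multiset ℕ) (h : ¬ Win R ((a + b) ::ₘ B)) :
    Win R (a ::ₘ b ::ₘ B) :=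
  .intro (.blue ..) h

theorem not_win_zero_left {M : Multiset ℕ} (hM : Odd M.card) : ¬ Win 0 M := by
  induction hn : M.card using Nat.strong_induction_on generalizing M with
  | _ n ih =>
  refine not_win_of fun R' B' h => ?_
  generalize hZ : (0 : Multiset ℕ) = Z at h
  cases h with
  | red | redEat | blueEat => simp at hZ
  | blue a b _ B =>
    subst hZ
    obtain rfl | ⟨c, hc⟩ := B.empty_or_exists_mem
    · simp [Nat.odd_iff] at hM
    · obtain ⟨C, rfl⟩ := Multiset.exists_cons_of_mem hc
      refine win_of_blue _ _ _ (ih (C.card + 1) ?_ ?_ (by simp)) <;>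
        simp only [Multiset.card_cons, Nat.odd_iff] at * <;> omega

theorem win_zero_left {M : Multiset ℕ} (hM : Even M.card) (h0 : M ≠ 0) : Win 0 M := by
  obtain ⟨a, ha⟩ := Multiset.exists_mem_of_ne_zero h0
  obtain ⟨M, rfl⟩ := Multiset.exists_cons_of_mem ha
  obtain rfl | ⟨c, hc⟩ := M.empty_or_exists_mem
  · simp at hM
  · obtain ⟨C, rfl⟩ := Multiset.exists_cons_of_mem hc
    refine win_of_blue _ _ _ (not_win_zero_left ?_)
    simp only [Multiset.card_cons, Nat.odd_iff, Nat.even_iff] at *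
    omega

/-- The heights `M` contain a stack larger than half of `G`, or at most `n` halves of `G`. -/
def Spread (n G : ℕ) (M : Multiset ℕ) : Prop :=
  (∃ w ∈ M, G < 2 * w) ∨ M.countP (fun w => 2 * w = G) ≤ n

theorem Spread.merge {n G a b : ℕ} {M : Multiset ℕ} (h : Spread n G (a ::ₘ b ::ₘ M)) :
    Spread (n + 1) G ((a + b) ::ₘ M) := by
  rcases h with ⟨w, hw, hG⟩ | h
  · left
    simp only [Multiset.mem_cons] at hw
    obtain rfl | rfl | hw := hw
    · exact ⟨_, Multiset.mem_cons_self _ _, by omega⟩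
    · exact ⟨_, Multiset.mem_cons_self _ _, by omega⟩
    · exact ⟨w, by simp [hw], hG⟩
  · right
    simp only [Multiset.countP_cons] at *
    split_ifs at * <;> omega

/-- Against a single stack `G` of the other color, an even number of stacks wins by merging,
provided that merging once can always be answered. -/
theorem win_singleton_of {G : ℕ} {M : Multiset ℕ} (hG : 0 < G) (hM : Even M.card) (h0 : M ≠ 0)
    (hpos : ∀ w ∈ M, 0 < w) (hsum : M.sum ≠ G) (hcount : M.count G ≤ 2) (hs : Spread 3 G M)
    (ih : ∀ M' : Multiset ℕ, M'.card < M.card → Odd M'.card → (∀ w ∈ M', 0 < w) → M'.sum ≠ G →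
      G ∉ M' → Spread 2 G M' → ¬ Win {G} M') : Win {G} M := by
  have merge (a b M' : _) (hab : M = a ::ₘ b ::ₘ M') (h1 : G ≠ a + b) (h2 : G ∉ M')
      (h3 : Spread 2 G ((a + b) ::ₘ M')) : Win {G} M := by
    subst hab
    refine win_of_blue _ _ _ (ih _ (by simp) ?_ ?_ ?_ ?_ h3)
    · simp only [Multiset.card_cons, Nat.odd_iff, Nat.even_iff] at *
      omega
    · intro w hw
      rcases Multiset.mem_cons.1 hw with rfl | hw
      · have := hpos a (by simp)
        omega
      · exact hpos w (by simp [hw])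
    · simpa [add_assoc] using hsum
    · simp [h1, h2]
  have exists_cons {M' : Multiset ℕ} (h : M' ≠ 0) : ∃ a M'', M' = a ::ₘ M'' := by
    obtain ⟨a, ha⟩ := Multiset.exists_mem_of_ne_zero h
    exact ⟨a, Multiset.exists_cons_of_mem ha⟩
  by_cases hGM : G ∈ M
  · obtain ⟨M, rfl⟩ := Multiset.exists_cons_of_mem hGM
    have hM0 : M ≠ 0 := by rintro rfl; simp at hM
    by_cases hGM' : G ∈ M
    · obtain ⟨M, rfl⟩ := Multiset.exists_cons_of_mem hGM'
      refine merge G G M rfl (by omega) ?_ (.inl ⟨_, Multiset.mem_cons_self _ _, by omega⟩)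
      rw [← Multiset.count_eq_zero]
      simp only [Multiset.count_cons_self] at hcount
      omega
    · obtain ⟨b, M, rfl⟩ := exists_cons hM0
      have := hpos b (by simp)
      exact merge G b M rfl (by omega) (fun h => hGM' (by simp [h]))
        (.inl ⟨_, Multiset.mem_cons_self _ _, by omega⟩)
  by_cases hw : ∃ w ∈ M, G < 2 * w
  · obtain ⟨w, hw, hwG⟩ := hw
    obtain ⟨M, rfl⟩ := Multiset.exists_cons_of_mem hw
    have hM0 : M ≠ 0 := by rintro rfl; simp at hM
    by_cases hz : ∃ z ∈ M, w + z ≠ G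
    · obtain ⟨z, hz, hzG⟩ := hz
      obtain ⟨M, rfl⟩ := Multiset.exists_cons_of_mem hz
      exact merge w z M rfl hzG.symm (fun h => hGM (by simp [h]))
        (.inl ⟨_, Multiset.mem_cons_self _ _, by omega⟩)
    · push Not at hz
      obtain ⟨z, M, rfl⟩ := exists_cons hM0
      have hz1 := hz z (by simp)
      have hM0 : M ≠ 0 := by
        rintro rfl
        simp [hz1] at hsum
      obtain ⟨z', M, rfl⟩ := exists_cons hM0
      have hz2 := hz z' (by simp)
      refine merge z z' (w ::ₘ M) ?_ (by omega) (fun h => hGM ?_) (.inl ⟨w, by simp, hwG⟩)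
      · rw [Multiset.cons_swap w z, Multiset.cons_swap w z']
      · simp only [Multiset.mem_cons] at *
        tauto
  have hc := hs.resolve_left hw
  push Not at hw
  by_cases hb : ∃ b ∈ M, 2 * b = G
  · obtain ⟨b, hb, hbG⟩ := hb
    obtain ⟨M, rfl⟩ := Multiset.exists_cons_of_mem hb
    by_cases ha : ∃ a ∈ M, 2 * a ≠ G
    · obtain ⟨a, ha, haG⟩ := ha
      obtain ⟨M, rfl⟩ := Multiset.exists_cons_of_mem ha
      have := hpos a (by simp)
      exact merge b a M rfl (by omega) (fun h => hGM (by simp [h]))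
        (.inl ⟨_, Multiset.mem_cons_self _ _, by omega⟩)
    · push Not at ha
      have hall : ∀ w ∈ M, w = b := fun w hw => by have := ha w hw; omega
      have hrep := Multiset.eq_replicate_card.2 hall
      have hcard : M.countP (fun w => 2 * w = G) = M.card := Multiset.countP_eq_card.2 ha
      simp only [Multiset.countP_cons, hcard, hbG, if_true, Multiset.card_cons, Nat.even_iff]
        at hc hM
      have h1 : M.card = 1 := by omega
      rw [h1] at hrep
      subst hrep
      simp at hsum
      omega
  · push Not at hb
    obtain ⟨a, M, rfl⟩ := exists_cons h0
    have hM0 : M ≠ 0 := by rintro rfl; simp at hM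
    obtain ⟨b, M, rfl⟩ := exists_cons hM0
    have h1 := hw a (by simp)
    have h2 := hb a (by simp)
    have h3 := hw b (by simp)
    have h4 : (a ::ₘ b ::ₘ M).countP (fun w => 2 * w = G) = 0 :=
      Multiset.countP_eq_zero.2 hb
    refine merge a b M rfl (by omega) (fun h => hGM (by simp [h])) (.inr ?_)
    simp only [Multiset.countP_cons] at *
    split_ifs at * <;> omega

theorem not_win_singleton {G : ℕ} {M : Multiset ℕ} (hG : 0 < G) (hM : Odd M.card)
    (hpos : ∀ w ∈ M, 0 < w) (hsum : M.sum ≠ G) (hGM : G ∉ M) (hs : Spread 2 G M) :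
    ¬ Win {G} M := by
  induction hn : M.card using Nat.strong_induction_on generalizing M with
  | _ n ih =>
  refine not_win_of fun R' B' h => ?_
  generalize hZ : ({G} : Multiset ℕ) = Z at h
  cases h with
  | red => simpa using congrArg Multiset.card hZ
  | redEat a R B =>
    obtain rfl : a = G := Multiset.mem_singleton.1 (by rw [hZ]; exact Multiset.mem_cons_self a _)
    simp at hGM
  | blueEat a R B =>
    obtain rfl : a = G := Multiset.mem_singleton.1 (by rw [hZ]; exact Multiset.mem_cons_self a _)
    simp at hGM
  | blue a b _ M =>
    subst hZ
    refine win_singleton_of hG ?_ (by simp) ?_ ?_ ?_ hs.merge ?_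
    · simp only [Multiset.card_cons, Nat.odd_iff, Nat.even_iff] at *
      omega
    · intro w hw
      rcases Multiset.mem_cons.1 hw with rfl | hw
      · have := hpos a (by simp)
        omega
      · exact hpos w (by simp [hw])
    · simpa [add_assoc] using hsum
    · have : M.count G = 0 := Multiset.count_eq_zero.2 fun h => hGM (by simp [h])
      rw [Multiset.count_cons, this]
      split_ifs <;> omega
    · intro M' hM' h1 h2 h3 h4 h5
      exact ih _ (by simp at hn hM' ⊢; omega) h1 h2 h3 h4 h5 rfl

theorem win_singleton {G : ℕ} {M : Multiset ℕ} (hG : 0 < G) (hM : Even M.card) (h0 : M ≠ 0)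
    (hpos : ∀ w ∈ M, 0 < w) (hsum : M.sum ≠ G) (hcount : M.count G ≤ 2) (hs : Spread 3 G M) :
    Win {G} M :=
  win_singleton_of hG hM h0 hpos hsum hcount hs fun _ _ h1 h2 h3 h4 h5 =>
    not_win_singleton hG h1 h2 h3 h4 h5

/-- Two stacks `u`, `v` of one color against an even number of stacks of the other color. -/
theorem not_win_pair {u v : ℕ} {M : Multiset ℕ} (hu : 0 < u) (hM : Even M.card) (h0 : M ≠ 0)
    (hpos : ∀ w ∈ M, 0 < w) (hsum : M.sum ≠ u + v) (huM : u ∉ M) (hvM : v ∉ M)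
    (hGM : u + v ∉ M) (hpair : ∀ a b M', M = a ::ₘ b ::ₘ M' → a + b ≠ u + v)
    (hs : Spread 1 (u + v) M) : ¬ Win {u, v} M := by
  have hs3 : Spread 3 (u + v) M := hs.imp_right (by omega)
  have hmem {a : ℕ} {R : Multiset ℕ} (h : ({u, v} : Multiset ℕ) = a ::ₘ R) : a ∉ M := by
    have : a ∈ ({u, v} : Multiset ℕ) := h ▸ Multiset.mem_cons_self a R
    simp only [Multiset.insert_eq_cons, Multiset.mem_cons, Multiset.mem_singleton] at this
    rcases this with rfl | rfl <;> assumption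
  refine not_win_of fun R' B' h => ?_
  generalize hZ : ({u, v} : Multiset ℕ) = Z at h
  cases h with
  | red a b R _ =>
    have hab := congrArg Multiset.sum hZ
    have hc := congrArg Multiset.card hZ
    simp only [Multiset.insert_eq_cons, Multiset.card_cons, Multiset.card_singleton] at hc
    obtain rfl : R = 0 := Multiset.card_eq_zero.1 (by omega)
    simp only [Multiset.insert_eq_cons, Multiset.sum_cons, Multiset.sum_singleton,
      Multiset.sum_zero, add_zero] at hab
    rw [← hab]
    exact win_singleton (by omega) hM h0 hpos hsum (by simp [Multiset.count_eq_zero.2 hGM]) hs3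
  | redEat => exact absurd (Multiset.mem_cons_self _ _) (hmem hZ)
  | blueEat => exact absurd (Multiset.mem_cons_self _ _) (hmem hZ)
  | blue a b _ M =>
    subst hZ
    refine win_of_red u v 0 (not_win_singleton (by omega) ?_ ?_ ?_ ?_ hs.merge)
    · simp only [Multiset.card_cons, Nat.odd_iff, Nat.even_iff] at *
      omega
    · intro w hw
      rcases Multiset.mem_cons.1 hw with rfl | hw
      · have := hpos a (by simp)
        omega
      · exact hpos w (by simp [hw])
    · simpa [add_assoc] using hsum
    · have := hpair a b M rfl
      simp only [Multiset.mem_cons, not_or] at *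
      exact ⟨this.symm, hGM.2.2⟩

/-- The heights `A` together with `k` singletons. -/
def pos (A : List ℕ) (k : ℕ) : Multiset ℕ := (A : Multiset ℕ) + Multiset.replicate k 1

/-- All ways to select an entry of a list, with the remaining entries. -/
def picks : List ℕ → List (ℕ × List ℕ)
  | [] => []
  | a :: l => (a, l) :: (picks l).map fun p => (p.1, a :: p.2)

theorem coe_of_mem_picks {A : List ℕ} {p : ℕ × List ℕ} (h : p ∈ picks A) :
    (A : Multiset ℕ) = p.1 ::ₘ (p.2 : Multiset ℕ) := by
  induction A generalizing p with
  | nil => simp [picks] at h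
  | cons a l ih =>
    simp only [picks, List.mem_cons, List.mem_map] at h
    obtain rfl | ⟨q, hq, rfl⟩ := h
    · rfl
    · rw [← Multiset.cons_coe, ih hq, Multiset.cons_swap]
      rfl

theorem exists_mem_picks {A : List ℕ} {a : ℕ} (h : a ∈ A) : ∃ C, (a, C) ∈ picks A := by
  induction A with
  | nil => simp at h
  | cons b l ih =>
    by_cases hab : a = b
    · exact ⟨l, by simp [picks, hab]⟩
    · obtain ⟨C, hC⟩ := ih (by simpa [hab] using h)
      exact ⟨b :: C, by simp [picks, hC]⟩

theorem pos_of_mem_picks {A : List ℕ} {p : ℕ × List ℕ} (h : p ∈ picks A) (k : ℕ) :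
    pos A k = p.1 ::ₘ pos p.2 k := by
  rw [pos, coe_of_mem_picks h, Multiset.cons_add, pos]

theorem pos_cons (a : ℕ) (A : List ℕ) (k : ℕ) : pos (a :: A) k = a ::ₘ pos A k :=
  pos_of_mem_picks (p := (a, A)) (by simp [picks]) k

theorem pos_succ (A : List ℕ) (k : ℕ) : pos A (k + 1) = 1 ::ₘ pos A k := by
  rw [pos, Multiset.replicate_succ, Multiset.add_cons, pos]

theorem pos_swap (a b : ℕ) (C : List ℕ) (k : ℕ) : pos (a :: b :: C) k = pos (b :: a :: C) k := by
  simp only [pos_cons, Multiset.cons_swap a b]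

theorem pos_eq_cons {A : List ℕ} {k a : ℕ} {R : Multiset ℕ} (h : pos A k = a ::ₘ R) :
    (∃ p ∈ picks A, p.1 = a ∧ R = pos p.2 k) ∨ (a = 1 ∧ ∃ k', k = k' + 1 ∧ R = pos A k') := by
  have ha : a ∈ pos A k := h ▸ Multiset.mem_cons_self a R
  simp only [pos, Multiset.mem_add, Multiset.mem_coe, Multiset.mem_replicate] at ha
  obtain ha | ⟨hk, rfl⟩ := ha
  · obtain ⟨C, hC⟩ := exists_mem_picks ha
    rw [pos_of_mem_picks hC, Multiset.cons_inj_right] at h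
    exact .inl ⟨_, hC, rfl, h.symm⟩
  · obtain ⟨k, rfl⟩ := Nat.exists_eq_succ_of_ne_zero hk
    rw [Nat.succ_eq_add_one, pos_succ, Multiset.cons_inj_right] at h
    exact .inr ⟨rfl, k, rfl, h.symm⟩

theorem one_not_picked {A : List ℕ} (hA : ∀ a ∈ A, 2 ≤ a) {p : ℕ × List ℕ} (hp : p ∈ picks A)
    (h1 : p.1 = 1) : False := by
  have : p.1 ∈ (A : Multiset ℕ) := by simp [coe_of_mem_picks hp]
  have := hA _ (Multiset.mem_coe.1 this)
  omega

theorem pos_eq_cons_cons {A : List ℕ} {k a b : ℕ} {R : Multiset ℕ} (h : pos A k = a ::ₘ b ::ₘ R) :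
    (∃ p ∈ picks A, ∃ q ∈ picks p.2, a = p.1 ∧ b = q.1 ∧ R = pos q.2 k) ∨
    (∃ p ∈ picks A, ∃ k', k = k' + 1 ∧ a + b = p.1 + 1 ∧ R = pos p.2 k') ∨
    (a = 1 ∧ b = 1 ∧ ∃ k', k = k' + 2 ∧ R = pos A k') := by
  obtain ⟨p, hp, rfl, h₁⟩ | ⟨rfl, k', rfl, h₁⟩ := pos_eq_cons h
  · obtain ⟨q, hq, rfl, h₂⟩ | ⟨rfl, k', rfl, h₂⟩ := pos_eq_cons h₁.symm
    · exact .inl ⟨p, hp, q, hq, rfl, rfl, h₂⟩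
    · exact .inr (.inl ⟨p, hp, k', rfl, rfl, h₂⟩)
  · obtain ⟨q, hq, rfl, h₂⟩ | ⟨rfl, k', rfl, h₂⟩ := pos_eq_cons h₁.symm
    · exact .inr (.inl ⟨q, hq, k', rfl, add_comm _ _, h₂⟩)
    · exact .inr (.inr ⟨rfl, rfl, k', rfl, h₂⟩)

/-- It suffices to answer every kind of move. -/
theorem not_win_pos {A B : List ℕ} {k o : ℕ} (hA : ∀ a ∈ A, 2 ≤ a) (hB : ∀ b ∈ B, 2 ≤ b)
    (rr : ∀ p ∈ picks A, ∀ q ∈ picks p.2, Win (pos ((p.1 + q.1) :: q.2) k) (pos B o))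
    (r1 : ∀ p ∈ picks A, ∀ k', k = k' + 1 → Win (pos ((p.1 + 1) :: p.2) k') (pos B o))
    (r11 : ∀ k', k = k' + 2 → Win (pos (2 :: A) k') (pos B o))
    (bb : ∀ p ∈ picks B, ∀ q ∈ picks p.2, Win (pos A k) (pos ((p.1 + q.1) :: q.2) o))
    (b1 : ∀ p ∈ picks B, ∀ o', o = o' + 1 → Win (pos A k) (pos ((p.1 + 1) :: p.2) o'))
    (b11 : ∀ o', o = o' + 2 → Win (pos A k) (pos (2 :: B) o'))
    (re : ∀ k' o', k = k' + 1 → o = o' + 1 → Win (pos (2 :: A) k') (pos B o'))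
    (be : ∀ k' o', k = k' + 1 → o = o' + 1 → Win (pos A k') (pos (2 :: B) o'))
    (rE : ∀ p ∈ picks A, ∀ q ∈ picks B, p.1 = q.1 → Win (pos ((p.1 + p.1) :: p.2) k) (pos q.2 o))
    (bE : ∀ p ∈ picks A, ∀ q ∈ picks B, p.1 = q.1 → Win (pos p.2 k) (pos ((p.1 + p.1) :: q.2) o)) :
    ¬ Win (pos A k) (pos B o) := by
  refine not_win_of fun R' B' h => ?_
  generalize hX : pos A k = X at h
  generalize hY : pos B o = Y at h
  cases h with
  | red a b R _ =>
    subst hY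
    obtain ⟨p, hp, q, hq, rfl, rfl, rfl⟩ | ⟨p, hp, k', hk, hab, rfl⟩ | ⟨rfl, rfl, k', hk, rfl⟩ :=
      pos_eq_cons_cons hX
    · simpa only [pos_cons] using rr p hp q hq
    · simpa only [pos_cons, hab] using r1 p hp k' hk
    · simpa only [pos_cons] using r11 k' hk
  | blue a b _ R =>
    subst hX
    obtain ⟨p, hp, q, hq, rfl, rfl, rfl⟩ | ⟨p, hp, k', hk, hab, rfl⟩ | ⟨rfl, rfl, k', hk, rfl⟩ :=
      pos_eq_cons_cons hY
    · simpa only [pos_cons] using bb p hp q hq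
    · simpa only [pos_cons, hab] using b1 p hp k' hk
    · simpa only [pos_cons] using b11 k' hk
  | redEat a R B =>
    obtain ⟨p, hp, rfl, rfl⟩ | ⟨rfl, k', hk, rfl⟩ := pos_eq_cons hX <;>
    obtain ⟨q, hq, hpq, rfl⟩ | ⟨hq, o', ho, rfl⟩ := pos_eq_cons hY
    · simpa only [pos_cons] using rE p hp q hq hpq.symm
    · exact (one_not_picked hA hp hq).elim
    · exact (one_not_picked hB hq hpq).elim
    · simpa only [pos_cons] using re k' o' hk ho
  | blueEat a R B =>
    obtain ⟨p, hp, rfl, rfl⟩ | ⟨rfl, k', hk, rfl⟩ := pos_eq_cons hX <;>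
    obtain ⟨q, hq, hpq, rfl⟩ | ⟨hq, o', ho, rfl⟩ := pos_eq_cons hY
    · simpa only [pos_cons] using bE p hp q hq hpq.symm
    · exact (one_not_picked hA hp hq).elim
    · exact (one_not_picked hB hq hpq).elim
    · simpa only [pos_cons] using be k' o' hk ho

section replies
variable {A B C D : List ℕ} {k o k' o' a b : ℕ}

theorem win_rr (h : ¬ Win (pos ((a + b) :: C) k) (pos B o)) :
    Win (pos (a :: b :: C) k) (pos B o) := by
  simp only [pos_cons] at *
  exact win_of_red _ _ _ h

theorem win_bb (h : ¬ Win (pos A k) (pos ((a + b) :: C) o)) :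
    Win (pos A k) (pos (a :: b :: C) o) := by
  simp only [pos_cons] at *
  exact win_of_blue _ _ _ h

theorem win_r1 (hA : (a, C) ∈ picks A := by simp [picks]) (hk : k = k' + 1 := by omega)
    (h : ¬ Win (pos ((a + 1) :: C) k') (pos B o)) : Win (pos A k) (pos B o) := by
  subst hk
  rw [pos_of_mem_picks hA, pos_succ]
  rw [pos_cons] at h
  exact win_of_red _ _ _ h

theorem win_b1 (hB : (b, C) ∈ picks B := by simp [picks]) (ho : o = o' + 1 := by omega)
    (h : ¬ Win (pos A k) (pos ((b + 1) :: C) o')) : Win (pos A k) (pos B o) := by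
  subst ho
  rw [pos_of_mem_picks hB, pos_succ]
  rw [pos_cons] at h
  exact win_of_blue _ _ _ h

theorem win_r11 (hk : k = k' + 2 := by omega) (h : ¬ Win (pos (2 :: A) k') (pos B o)) :
    Win (pos A k) (pos B o) := by
  subst hk
  rw [pos_succ, pos_succ]
  rw [pos_cons] at h
  exact win_of_red _ _ _ h

theorem win_b11 (ho : o = o' + 2 := by omega) (h : ¬ Win (pos A k) (pos (2 :: B) o')) :
    Win (pos A k) (pos B o) := by
  subst ho
  rw [pos_succ, pos_succ]
  rw [pos_cons] at h
  exact win_of_blue _ _ _ h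

theorem win_re (hk : k = k' + 1 := by omega) (ho : o = o' + 1 := by omega)
    (h : ¬ Win (pos (2 :: A) k') (pos B o')) :
    Win (pos A k) (pos B o) := by
  subst hk ho
  rw [pos_succ, pos_succ]
  rw [pos_cons] at h
  exact .intro (.redEat ..) h

theorem win_be (hk : k = k' + 1 := by omega) (ho : o = o' + 1 := by omega)
    (h : ¬ Win (pos A k') (pos (2 :: B) o')) :
    Win (pos A k) (pos B o) := by
  subst hk ho
  rw [pos_succ, pos_succ]
  rw [pos_cons] at h
  exact .intro (.blueEat ..) h

theorem win_rE (hA : (a, C) ∈ picks A := by simp [picks]) (hB : (a, D) ∈ picks B := by simp [picks])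
    (h : ¬ Win (pos ((a + a) :: C) k) (pos D o)) : Win (pos A k) (pos B o) := by
  rw [pos_of_mem_picks hA, pos_of_mem_picks hB]
  rw [pos_cons] at h
  exact .intro (.redEat ..) h

theorem win_bE (hA : (a, C) ∈ picks A := by simp [picks]) (hB : (a, D) ∈ picks B := by simp [picks])
    (h : ¬ Win (pos C k) (pos ((a + a) :: D) o)) : Win (pos A k) (pos B o) := by
  rw [pos_of_mem_picks hA, pos_of_mem_picks hB]
  rw [pos_cons] at h
  exact .intro (.blueEat ..) h

end replies

theorem card_pos (A : List ℕ) (k : ℕ) : (pos A k).card = A.length + k := by simp [pos]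

theorem sum_pos (A : List ℕ) (k : ℕ) : (pos A k).sum = A.sum + k := by simp [pos]

theorem mem_pos {A : List ℕ} {k w : ℕ} : w ∈ pos A k ↔ w ∈ A ∨ k ≠ 0 ∧ w = 1 := by
  simp [pos, Multiset.mem_replicate]

theorem spread_pos {n G : ℕ} {A : List ℕ} {k : ℕ}
    (h : (∃ a ∈ A, G < 2 * a) ∨ A.countP (fun a => 2 * a = G) + (if G = 2 then k else 0) ≤ n) :
    Spread n G (pos A k) := by
  refine h.imp (fun ⟨a, ha, hG⟩ => ⟨a, mem_pos.2 (.inl ha), hG⟩) fun h => ?_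
  have : (Multiset.replicate k 1).countP (fun a => 2 * a = G) = if G = 2 then k else 0 := by
    rw [← Multiset.coe_replicate, Multiset.coe_countP, List.countP_replicate]
    simp [eq_comm]
  rw [pos, Multiset.countP_add, Multiset.coe_countP, this]
  exact h

/-- `not_win_singleton` for a list of heights and some singletons. -/
theorem not_win_pos_singleton {G : ℕ} {B : List ℕ} {o : ℕ} (hG : 2 ≤ G := by omega)
    (hB : ∀ b ∈ B, 2 ≤ b ∧ b ≠ G := by simp <;> omega)
    (hodd : (B.length + o) % 2 = 1 := by simp <;> omega) (hsum : B.sum + o ≠ G := by simp <;> omega)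
    (hs : (∃ b ∈ B, G < 2 * b) ∨ B.countP (fun b => 2 * b = G) + (if G = 2 then o else 0) ≤ 2 := by
      simp [List.countP_cons] <;> (try split_ifs) <;> omega) :
    ¬ Win (pos [G] 0) (pos B o) := by
  refine not_win_singleton (by omega) (by rwa [card_pos, Nat.odd_iff]) ?_ (by rwa [sum_pos]) ?_
    (spread_pos hs)
  · intro w hw
    rcases mem_pos.1 hw with hw | hw
    · have := hB w hw
      omega
    · omega
  · rw [mem_pos]
    rintro (h | h)
    · exact (hB G h).2 rfl
    · omega

/-- `win_singleton` for a list of heights and some singletons. -/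
theorem win_pos_singleton {G : ℕ} {B : List ℕ} {o : ℕ} (hG : 2 ≤ G := by omega)
    (hB : ∀ b ∈ B, 2 ≤ b := by simp <;> omega)
    (heven : (B.length + o) % 2 = 0 := by simp <;> omega)
    (h0 : B.length + o ≠ 0 := by simp <;> omega) (hsum : B.sum + o ≠ G := by simp <;> omega)
    (hcount : B.count G ≤ 2 := by simp [List.count_cons] <;> (try split_ifs) <;> omega)
    (hs : (∃ b ∈ B, G < 2 * b) ∨ B.countP (fun b => 2 * b = G) + (if G = 2 then o else 0) ≤ 3 := by
      simp [List.countP_cons] <;> (try split_ifs) <;> omega) :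
    Win (pos [G] 0) (pos B o) := by
  refine win_singleton (by omega) (by rwa [card_pos, Nat.even_iff]) ?_ ?_ (by rwa [sum_pos]) ?_
    (spread_pos hs)
  · rw [← Multiset.card_pos, card_pos]
    omega
  · intro w hw
    rcases mem_pos.1 hw with hw | hw
    · have := hB w hw
      omega
    · omega
  · rw [pos, Multiset.count_add, Multiset.coe_count, Multiset.count_replicate, if_neg (by omega)]
    exact hcount

/-- `not_win_pair` for a list of heights and some singletons. -/
theorem not_win_pos_pair {A B : List ℕ} {k o : ℕ} (u v : ℕ) (hA : pos A k = {u, v} := by rfl)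
    (hu : 0 < u := by omega) (hv : 0 < v := by omega)
    (hB : ∀ b ∈ B, 2 ≤ b ∧ b ≠ u ∧ b ≠ v ∧ b ≠ u + v ∧ (o = 0 ∨ b + 1 ≠ u + v) := by simp <;> omega)
    (h1 : o = 0 ∨ u ≠ 1 ∧ v ≠ 1 := by omega)
    (heven : (B.length + o) % 2 = 0 := by simp <;> omega)
    (h0 : B.length + o ≠ 0 := by simp <;> omega) (hsum : B.sum + o ≠ u + v := by simp <;> omega)
    (hpair : ∀ p ∈ picks B, ∀ q ∈ picks p.2, p.1 + q.1 ≠ u + v := by simp [picks] <;> omega)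
    (hs : (∃ b ∈ B, u + v < 2 * b) ∨
      B.countP (fun b => 2 * b = u + v) + (if u + v = 2 then o else 0) ≤ 1 := by
      simp [List.countP_cons] <;> (try split_ifs) <;> omega) :
    ¬ Win (pos A k) (pos B o) := by
  rw [hA]
  refine not_win_pair hu (by rwa [card_pos, Nat.even_iff]) ?_ ?_ (by rwa [sum_pos]) ?_ ?_ ?_ ?_
    (spread_pos hs)
  · rw [← Multiset.card_pos, card_pos]
    omega
  · intro w hw
    rcases mem_pos.1 hw with hw | hw
    · have := hB w hw
      omega
    · omega
  · rw [mem_pos]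
    rintro (h | h)
    · exact (hB u h).2.1 rfl
    · omega
  · rw [mem_pos]
    rintro (h | h)
    · exact (hB v h).2.2.1 rfl
    · omega
  · rw [mem_pos]
    rintro (h | h)
    · exact (hB _ h).2.2.2.1 rfl
    · omega
  · intro a b M' h
    obtain ⟨p, hp, q, hq, rfl, rfl, -⟩ | ⟨p, hp, k', rfl, hab, -⟩ | ⟨rfl, rfl, k', rfl, -⟩ :=
      pos_eq_cons_cons h
    · exact hpair p hp q hq
    · have hmem : p.1 ∈ (B : Multiset ℕ) := by simp [coe_of_mem_picks hp]
      have := hB p.1 hmem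
      omega
    · omega

/-- Two stacks of each color. -/
theorem not_win_two_pairs {A B : List ℕ} {k o : ℕ} (a b c d : ℕ)
    (hA : pos A k = {a, b} := by rfl) (hB : pos B o = {c, d} := by rfl)
    (ha : 0 < a := by omega) (hb : 0 < b := by omega) (hc : 0 < c := by omega)
    (hd : 0 < d := by omega) (hsum : a + b ≠ c + d := by omega)
    (h1 : a = c ∨ a = d → a + b + 2 * a ≠ c + d ∧ c + d + 2 * a ≠ a + b := by omega)
    (h2 : b = c ∨ b = d → a + b + 2 * b ≠ c + d ∧ c + d + 2 * b ≠ a + b := by omega) :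
    ¬ Win (pos A k) (pos B o) := by
  have single {x y : ℕ} (hx : 0 < x) (hy : 0 < y) (hxy : x ≠ y) : ¬ Win {x} {y} :=
    not_win_singleton hx (by simp) (by simpa using hy) (by simpa using hxy.symm)
      (by simpa using hxy) (.inr ((Multiset.countP_le_card _ _).trans (by simp)))
  have eq_singleton {x y z : ℕ} {R : Multiset ℕ} (h : ({x, y} : Multiset ℕ) = z ::ₘ R) :
      ∃ r, R = {r} ∧ z + r = x + y ∧ (z = x ∨ z = y) := by
    have hz : z ∈ ({x, y} : Multiset ℕ) := h ▸ Multiset.mem_cons_self z R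
    obtain ⟨r, rfl⟩ := Multiset.card_eq_one.1
      (show R.card = 1 by simpa using (congrArg Multiset.card h).symm)
    exact ⟨r, rfl, by simpa using (congrArg Multiset.sum h).symm, by simpa using hz⟩
  have eq_zero {x y z w : ℕ} {R : Multiset ℕ} (h : ({x, y} : Multiset ℕ) = z ::ₘ w ::ₘ R) :
      R = 0 ∧ z + w = x + y := by
    obtain rfl : R = 0 := Multiset.card_eq_zero.1
      (by simpa using (congrArg Multiset.card h).symm)
    exact ⟨rfl, by simpa using (congrArg Multiset.sum h).symm⟩
  rw [hA, hB]
  refine not_win_of fun R' B' h => ?_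
  generalize hX : ({a, b} : Multiset ℕ) = X at h
  generalize hY : ({c, d} : Multiset ℕ) = Y at h
  cases h with
  | red x y R _ =>
    obtain ⟨rfl, hxy⟩ := eq_zero hX
    rw [← hY]
    exact win_of_blue c d 0 (single (by omega) (by omega) (by omega))
  | blue x y _ B =>
    obtain ⟨rfl, hxy⟩ := eq_zero hY
    rw [← hX]
    exact win_of_red a b 0 (single (by omega) (by omega) (by omega))
  | redEat x R B =>
    obtain ⟨r, rfl, hr, hx⟩ := eq_singleton hX
    obtain ⟨s, rfl, hs, hx'⟩ := eq_singleton hY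
    refine win_of_red (x + x) r 0 (single (by omega) ?_ ?_) <;>
      rcases hx with rfl | rfl <;> rcases hx' with rfl | rfl <;> omega
  | blueEat x R B =>
    obtain ⟨r, rfl, hr, hx⟩ := eq_singleton hX
    obtain ⟨s, rfl, hs, hx'⟩ := eq_singleton hY
    refine win_of_blue (x + x) s 0 (single ?_ (by omega) ?_) <;>
      rcases hx with rfl | rfl <;> rcases hx' with rfl | rfl <;> omega

section shapes
variable {k o x y a b c d : ℕ}

theorem not_win_one_zero (hx : 2 ≤ x)
    (r1 : ∀ k', k = k' + 1 → Win (pos [x + 1] k') (pos [] o))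
    (r11 : ∀ k', k = k' + 2 → Win (pos [2, x] k') (pos [] o))
    (b11 : ∀ o', o = o' + 2 → Win (pos [x] k) (pos [2] o'))
    (re : ∀ k' o', k = k' + 1 → o = o' + 1 → Win (pos [2, x] k') (pos [] o'))
    (be : ∀ k' o', k = k' + 1 → o = o' + 1 → Win (pos [x] k') (pos [2] o')) :
    ¬ Win (pos [x] k) (pos [] o) :=
  not_win_pos (by simpa using hx) (by simp) (by simp [picks]) (by simpa [picks] using r1) r11
    (by simp [picks]) (by simp [picks]) b11 re be (by simp [picks]) (by simp [picks])

theorem not_win_one_one (hx : 2 ≤ x) (hy : 2 ≤ y)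
    (r1 : ∀ k', k = k' + 1 → Win (pos [x + 1] k') (pos [y] o))
    (r11 : ∀ k', k = k' + 2 → Win (pos [2, x] k') (pos [y] o))
    (b1 : ∀ o', o = o' + 1 → Win (pos [x] k) (pos [y + 1] o'))
    (b11 : ∀ o', o = o' + 2 → Win (pos [x] k) (pos [2, y] o'))
    (re : ∀ k' o', k = k' + 1 → o = o' + 1 → Win (pos [2, x] k') (pos [y] o'))
    (be : ∀ k' o', k = k' + 1 → o = o' + 1 → Win (pos [x] k') (pos [2, y] o'))
    (rE : x = y → Win (pos [x + x] k) (pos [] o))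
    (bE : x = y → Win (pos [] k) (pos [x + x] o)) :
    ¬ Win (pos [x] k) (pos [y] o) :=
  not_win_pos (by simpa using hx) (by simpa using hy) (by simp [picks])
    (by simpa [picks] using r1) r11 (by simp [picks]) (by simpa [picks] using b1) b11 re be
    (by simpa [picks] using rE) (by simpa [picks] using bE)

theorem not_win_one_two (hx : 2 ≤ x) (ha : 2 ≤ a) (hb : 2 ≤ b)
    (r1 : ∀ k', k = k' + 1 → Win (pos [x + 1] k') (pos [a, b] o))
    (r11 : ∀ k', k = k' + 2 → Win (pos [2, x] k') (pos [a, b] o))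
    (bb : Win (pos [x] k) (pos [a + b] o))
    (b1a : ∀ o', o = o' + 1 → Win (pos [x] k) (pos [a + 1, b] o'))
    (b1b : ∀ o', o = o' + 1 → Win (pos [x] k) (pos [b + 1, a] o'))
    (b11 : ∀ o', o = o' + 2 → Win (pos [x] k) (pos [2, a, b] o'))
    (re : ∀ k' o', k = k' + 1 → o = o' + 1 → Win (pos [2, x] k') (pos [a, b] o'))
    (be : ∀ k' o', k = k' + 1 → o = o' + 1 → Win (pos [x] k') (pos [2, a, b] o'))
    (rEa : x = a → Win (pos [x + x] k) (pos [b] o))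
    (rEb : x = b → Win (pos [x + x] k) (pos [a] o))
    (bEa : x = a → Win (pos [] k) (pos [x + x, b] o))
    (bEb : x = b → Win (pos [] k) (pos [x + x, a] o)) :
    ¬ Win (pos [x] k) (pos [a, b] o) :=
  not_win_pos (by simpa using hx) (by simp [ha, hb]) (by simp [picks])
    (by simpa [picks] using r1) r11 (by simpa [picks, add_comm b a] using bb)
    (by simpa [picks] using ⟨b1a, b1b⟩) b11 re be
    (by simpa [picks] using ⟨rEa, rEb⟩) (by simpa [picks] using ⟨bEa, bEb⟩)

theorem not_win_one_three (hx : 2 ≤ x) (ha : 2 ≤ a) (hb : 2 ≤ b) (hc : 2 ≤ c)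
    (r1 : ∀ k', k = k' + 1 → Win (pos [x + 1] k') (pos [a, b, c] o))
    (r11 : ∀ k', k = k' + 2 → Win (pos [2, x] k') (pos [a, b, c] o))
    (bab : Win (pos [x] k) (pos [a + b, c] o))
    (bac : Win (pos [x] k) (pos [a + c, b] o))
    (bbc : Win (pos [x] k) (pos [b + c, a] o))
    (b1a : ∀ o', o = o' + 1 → Win (pos [x] k) (pos [a + 1, b, c] o'))
    (b1b : ∀ o', o = o' + 1 → Win (pos [x] k) (pos [b + 1, a, c] o'))
    (b1c : ∀ o', o = o' + 1 → Win (pos [x] k) (pos [c + 1, a, b] o'))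
    (b11 : ∀ o', o = o' + 2 → Win (pos [x] k) (pos [2, a, b, c] o'))
    (re : ∀ k' o', k = k' + 1 → o = o' + 1 → Win (pos [2, x] k') (pos [a, b, c] o'))
    (be : ∀ k' o', k = k' + 1 → o = o' + 1 → Win (pos [x] k') (pos [2, a, b, c] o'))
    (h : x ≠ a ∧ x ≠ b ∧ x ≠ c) :
    ¬ Win (pos [x] k) (pos [a, b, c] o) :=
  not_win_pos (by simpa using hx) (by simp [ha, hb, hc]) (by simp [picks])
    (by simpa [picks] using r1) r11
    (by simpa [picks, or_imp, forall_and, add_comm b a, add_comm c a, add_comm c b] using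
      ⟨⟨bab, bac⟩, ⟨bab, bbc⟩, ⟨bac, bbc⟩⟩)
    (by simpa [picks] using ⟨b1a, b1b, b1c⟩) b11 re be
    (by simp [picks, h]) (by simp [picks, h])

theorem not_win_two_two (ha : 2 ≤ a) (hb : 2 ≤ b) (hc : 2 ≤ c) (hd : 2 ≤ d)
    (rr : Win (pos [a + b] k) (pos [c, d] o))
    (r1a : ∀ k', k = k' + 1 → Win (pos [a + 1, b] k') (pos [c, d] o))
    (r1b : ∀ k', k = k' + 1 → Win (pos [b + 1, a] k') (pos [c, d] o))
    (r11 : ∀ k', k = k' + 2 → Win (pos [2, a, b] k') (pos [c, d] o))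
    (bb : Win (pos [a, b] k) (pos [c + d] o))
    (b1c : ∀ o', o = o' + 1 → Win (pos [a, b] k) (pos [c + 1, d] o'))
    (b1d : ∀ o', o = o' + 1 → Win (pos [a, b] k) (pos [d + 1, c] o'))
    (b11 : ∀ o', o = o' + 2 → Win (pos [a, b] k) (pos [2, c, d] o'))
    (re : ∀ k' o', k = k' + 1 → o = o' + 1 → Win (pos [2, a, b] k') (pos [c, d] o'))
    (be : ∀ k' o', k = k' + 1 → o = o' + 1 → Win (pos [a, b] k') (pos [2, c, d] o'))
    (ac : a = c → Win (pos [a + a, b] k) (pos [d] o) ∧ Win (pos [b] k) (pos [a + a, d] o))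
    (ad : a = d → Win (pos [a + a, b] k) (pos [c] o) ∧ Win (pos [b] k) (pos [a + a, c] o))
    (bc : b = c → Win (pos [b + b, a] k) (pos [d] o) ∧ Win (pos [a] k) (pos [b + b, d] o))
    (bd : b = d → Win (pos [b + b, a] k) (pos [c] o) ∧ Win (pos [a] k) (pos [b + b, c] o)) :
    ¬ Win (pos [a, b] k) (pos [c, d] o) :=
  not_win_pos (by simp [ha, hb]) (by simp [hc, hd])
    (by simpa [picks, add_comm b a] using rr)
    (by simpa [picks] using ⟨r1a, r1b⟩) r11
    (by simpa [picks, add_comm d c] using bb)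
    (by simpa [picks] using ⟨b1c, b1d⟩) b11 re be
    (by simpa [picks] using ⟨⟨fun h => (ac h).1, fun h => (ad h).1⟩,
      fun h => (bc h).1, fun h => (bd h).1⟩)
    (by simpa [picks] using ⟨⟨fun h => (ac h).2, fun h => (ad h).2⟩,
      fun h => (bc h).2, fun h => (bd h).2⟩)

end shapes

theorem not_win_two_one {y o : ℕ} (hy : 4 ≤ y := by omega) (hy2 : y % 2 = 0 := by omega)
    (ho : 3 ≤ o := by omega) (ho2 : o % 2 = 1 := by omega) :
    ¬ Win (pos [2] 1) (pos [y] o) := by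
  refine not_win_one_one le_rfl (by omega) ?_ (by omega) ?_ ?_ ?_ ?_ (by omega) (by omega)
  · intro k' hk
    obtain rfl : k' = 0 := by omega
    exact win_pos_singleton
  · intro o' ho'
    exact win_r1 (a := 2) (C := []) (k' := 0) (h := not_win_pos_singleton)
  · intro o' ho'
    exact win_r1 (a := 2) (C := []) (k' := 0) (h := not_win_pos_singleton)
  · intro k' o' hk ho'
    obtain rfl : k' = 0 := by omega
    by_cases hy4 : y = 4
    · subst hy4
      exact win_b1 (b := 4) (C := []) (o' := o' - 1) (h := not_win_pos_pair 2 2)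
    · exact win_rr not_win_pos_singleton
  · intro k' o' hk ho'
    obtain rfl : k' = 0 := by omega
    exact win_pos_singleton

theorem not_win_equal {x o : ℕ} (hx : 2 ≤ x := by omega)
    (ho : 3 ≤ o := by omega) (ho2 : o % 2 = 1 := by omega) :
    ¬ Win (pos [x] 1) (pos [x] o) := by
  refine not_win_one_one hx hx ?_ (by omega) ?_ ?_ ?_ ?_ ?_ ?_
  · intro k' hk
    obtain rfl : k' = 0 := by omega
    exact win_b11 (o' := o - 2) (h := not_win_pos_singleton)
  · intro o' ho'
    by_cases hx2 : x = 2
    · subst hx2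
      by_cases ho3 : o = 3
      · obtain rfl : o' = 2 := by omega
        exact win_b11 (o' := 0) (h := not_win_two_pairs 2 1 2 3)
      · exact win_b1 (b := 3) (C := []) (o' := o' - 1) (h := not_win_two_one)
    · exact win_be (k' := 0) (o' := o' - 1) (h := not_win_pos_singleton)
  · intro o' ho'
    exact win_r1 (a := x) (C := []) (k' := 0) (h := not_win_pos_singleton)
  · intro k' o' hk ho'
    obtain rfl : k' = 0 := by omega
    by_cases ho3 : o = 3
    · exact win_rE (a := x) (C := [2]) (D := []) (h := not_win_pos_pair (x + x) 2)
    · exact win_rr not_win_pos_singleton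
  · intro k' o' hk ho'
    obtain rfl : k' = 0 := by omega
    exact win_pos_singleton
  · rintro -
    by_cases hox : o = 2 * x + 1
    · exact win_re (k' := 0) (o' := o - 1) (h := not_win_pos_pair 2 (x + x))
    · exact win_r1 (a := x + x) (C := []) (k' := 0) (h := not_win_pos_singleton)
  · rintro -
    exact win_re (k' := 0) (o' := o - 1) (h := not_win_pos_singleton)

theorem not_win_pair_two_two {x y o : ℕ} (hxy : x + 2 = y + o := by omega) (hy : 2 ≤ y := by omega)
    (ho : 4 ≤ o := by omega) (ho2 : o % 2 = 0 := by omega) :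
    ¬ Win (pos [2, x] 0) (pos [2, y] o) := by
  refine not_win_two_two le_rfl (by omega) le_rfl hy win_pos_singleton (by omega) (by omega)
    (by omega) ?_
    ?_ ?_ ?_ (by omega) (by omega) ?_ ?_ (by omega) (by omega)
  · exact win_rr not_win_pos_singleton
  · intro o' ho'
    exact win_rr not_win_pos_singleton
  · intro o' ho'
    exact win_rr not_win_pos_singleton
  · intro o' ho'
    exact win_rr not_win_pos_singleton
  · rintro -
    exact ⟨win_rr not_win_pos_singleton, win_pos_singleton⟩
  · rintro rfl
    exact ⟨win_rr not_win_pos_singleton, win_pos_singleton⟩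

theorem not_win_one_two_two {x y o : ℕ} (hxy : x + 1 = y + o := by omega) (hy : 2 ≤ y := by omega)
    (ho : 4 ≤ o := by omega) (ho2 : o % 2 = 0 := by omega) :
    ¬ Win (pos [x] 1) (pos [2, y] o) := by
  have merge {B : List ℕ} {o' : ℕ} (h : ¬ Win (pos [x + 1] 0) (pos B o')) :
      Win (pos [x] 1) (pos B o') :=
    win_r1 (a := x) (C := []) (k' := 0) (h := h)
  refine not_win_one_two (by omega) le_rfl hy ?_ (by omega) (merge not_win_pos_singleton) ?_ ?_
    ?_ ?_ ?_ (by omega)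
    (by omega) (by omega) (by omega)
  · intro k' hk
    obtain rfl : k' = 0 := by omega
    exact win_pos_singleton
  · intro o' ho'
    exact merge not_win_pos_singleton
  · intro o' ho'
    exact merge not_win_pos_singleton
  · intro o' ho'
    exact merge not_win_pos_singleton
  · intro k' o' hk ho'
    obtain rfl : k' = 0 := by omega
    exact win_bE (a := 2) (C := [x]) (D := [y]) (h := not_win_pos_singleton)
  · intro k' o' hk ho'
    obtain rfl : k' = 0 := by omega
    exact win_pos_singleton

theorem not_win_one_two_of_eq {x : ℕ} (hx : 4 ≤ x := by omega) (hx2 : x % 2 = 0 := by omega) :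
    ¬ Win (pos [x] 1) (pos [2] (x + 1)) := by
  have merge {B : List ℕ} {o' : ℕ} (h : ¬ Win (pos [x + 1] 0) (pos B o')) :
      Win (pos [x] 1) (pos B o') :=
    win_r1 (a := x) (C := []) (k' := 0) (h := h)
  refine not_win_one_one (by omega) le_rfl ?_ (by omega) ?_ ?_ ?_ ?_ (by omega) (by omega)
  · intro k' hk
    obtain rfl : k' = 0 := by omega
    exact win_pos_singleton
  · intro o' ho'
    exact merge not_win_pos_singleton
  · intro o' ho'
    exact merge not_win_pos_singleton
  · intro k' o' hk ho'
    obtain rfl : k' = 0 := by omega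
    exact win_rE (a := 2) (C := [x]) (D := []) (h := not_win_pos_pair 4 x)
  · intro k' o' hk ho'
    obtain rfl : k' = 0 := by omega
    exact win_pos_singleton

theorem not_win_one_two_two_two {x y o : ℕ} (hxy : x = y + o + 1 := by omega)
    (hy : 2 ≤ y := by omega) (ho : 3 ≤ o := by omega) (ho2 : o % 2 = 1 := by omega) :
    ¬ Win (pos [x] 1) (pos [2, 2, y] o) := by
  have merge {B : List ℕ} {o' : ℕ} (h : ¬ Win (pos [x + 1] 0) (pos B o')) :
      Win (pos [x] 1) (pos B o') :=
    win_r1 (a := x) (C := []) (k' := 0) (h := h)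
  refine not_win_one_three (by omega) le_rfl le_rfl hy ?_ (by omega)
    (merge not_win_pos_singleton) (merge not_win_pos_singleton)
    (merge not_win_pos_singleton) ?_ ?_ ?_ ?_ ?_ ?_ (by omega)
  · intro k' hk
    obtain rfl : k' = 0 := by omega
    exact win_pos_singleton
  · intro o' ho'
    exact merge not_win_pos_singleton
  · intro o' ho'
    exact merge not_win_pos_singleton
  · intro o' ho'
    exact merge not_win_pos_singleton
  · intro o' ho'
    exact merge not_win_pos_singleton
  · intro k' o' hk ho'
    obtain rfl : k' = 0 := by omega
    exact win_bE (a := 2) (C := [x]) (D := [2, y]) (h := not_win_pos_singleton)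
  · intro k' o' hk ho'
    obtain rfl : k' = 0 := by omega
    exact win_pos_singleton

theorem not_win_pair_two_four {x y o : ℕ} (hxy : x + 2 = y + o := by omega)
    (hy : 2 ≤ y := by omega) (ho : 4 ≤ o := by omega) (ho2 : o % 2 = 0 := by omega) :
    ¬ Win (pos [2, x] 0) (pos [4, y] o) := by
  refine not_win_two_two le_rfl (by omega) (by omega) hy win_pos_singleton (by omega) (by omega)
    (by omega) ?_
    ?_ ?_ ?_ (by omega) (by omega) (by omega) ?_ ?_ (by omega)
  · by_cases ho4 : o = 4
    · exact win_b1 (b := 4 + y) (C := []) (o' := o - 1) (h := not_win_pos_pair 2 x)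
    · exact win_rr not_win_pos_singleton
  · intro o' ho'
    exact win_rr not_win_pos_singleton
  · intro o' ho'
    exact win_rr not_win_pos_singleton
  · intro o' ho'
    exact win_rr not_win_pos_singleton
  · rintro rfl
    exact ⟨win_rE (a := 4) (C := [x]) (D := []) (h := not_win_pos_pair 8 x), win_pos_singleton⟩
  · rintro rfl
    exact ⟨win_rr not_win_pos_singleton, win_pos_singleton⟩

theorem not_win_two_one_two {x y o : ℕ} (hxy : x + 3 = y + o := by omega)
    (hy : 2 ≤ y := by omega) (ho : 5 ≤ o := by omega) (ho2 : o % 2 = 1 := by omega) :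
    ¬ Win (pos [2, x] 1) (pos [2, y] o) := by
  have grow {B : List ℕ} {o' a : ℕ} (h : ¬ Win (pos [x + 1, a] 0) (pos B o')) :
      Win (pos [a, x] 1) (pos B o') :=
    win_r1 (a := x) (C := [a]) (k' := 0) (h := h)
  have merge {B : List ℕ} {o' : ℕ} (h : ¬ Win (pos [x + 1] 0) (pos B o')) :
      Win (pos [x] 1) (pos B o') :=
    win_r1 (a := x) (C := []) (k' := 0) (h := h)
  have eat {y : ℕ} (h : x + 3 = y + o) (hy : 2 ≤ y) : Win (pos [4, x] 1) (pos [y] o) := by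
    by_cases hy4 : y = 4
    · subst hy4
      exact win_r1 (a := 4) (C := [x]) (k' := 0) (h := not_win_pos_pair 5 x)
    · exact grow (not_win_pos_pair (x + 1) 4)
  refine not_win_two_two le_rfl (by omega) le_rfl hy ?_ ?_ ?_ (by omega) ?_
    ?_ ?_ ?_ ?_ ?_ ?_ ?_ (by omega) (by omega)
  · exact win_r1 (a := 2 + x) (C := []) (k' := 0) (h := not_win_pos_singleton)
  · intro k' hk
    obtain rfl : k' = 0 := by omega
    exact win_rr not_win_pos_singleton
  · intro k' hk
    obtain rfl : k' = 0 := by omega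
    exact win_rr not_win_pos_singleton
  · exact grow (not_win_pos_pair (x + 1) 2)
  · intro o' ho'
    by_cases hy2 : y = 2
    · subst hy2
      refine grow ?_
      rw [pos_swap _ 2, pos_swap _ 2]
      exact not_win_pair_two_two
    · exact grow (not_win_pos_pair (x + 1) 2)
  · intro o' ho'
    refine grow ?_
    rw [pos_swap _ 2, pos_swap _ 2]
    exact not_win_pair_two_two
  · intro o' ho'
    exact win_rr not_win_one_two_two_two
  · intro k' o' hk ho'
    obtain rfl : k' = 0 := by omega
    exact win_bE (a := 2) (C := [2, x]) (D := [y]) (h := not_win_pair_two_four)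
  · intro k' o' hk ho'
    obtain rfl : k' = 0 := by omega
    exact win_rr not_win_pos_singleton
  · rintro -
    exact ⟨eat hxy hy, merge not_win_pos_singleton⟩
  · rintro rfl
    exact ⟨eat hxy hy, merge not_win_pos_singleton⟩

theorem not_win_one_one_of_odd {x y k o : ℕ}
    (h : 2 ≤ x ∧ 2 ≤ y ∧ (x + y) % 2 = 1 ∧ k ≤ o ∧ (k + o) % 2 = 0) :
    ¬ Win (pos [x] k) (pos [y] o) := by
  induction hn : k + o using Nat.strong_induction_on generalizing x y k o with
  | _ n ih =>
  replace ih (x y k o : ℕ) (h : k + o < n ∧ 2 ≤ x ∧ 2 ≤ y ∧ (x + y) % 2 = 1 ∧ k ≤ o ∧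
      (k + o) % 2 = 0) : ¬ Win (pos [x] k) (pos [y] o) := ih _ h.1 h.2 rfl
  refine not_win_one_one h.1 h.2.1 ?_ ?_ ?_ ?_ ?_ ?_ (by omega) (by omega)
  · intro k' hk
    exact win_b1 (b := y) (C := []) (o' := o - 1) (h := ih _ _ _ _ (by omega))
  · intro k' hk
    exact win_rr (ih _ _ _ _ (by omega))
  · intro o' ho
    by_cases hko : k = o
    · exact win_r1 (a := x) (C := []) (k' := k - 1) (h := ih _ _ _ _ (by omega))
    · exact win_b1 (b := y + 1) (C := []) (o' := o' - 1) (h := ih _ _ _ _ (by omega))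
  · intro o' ho
    by_cases hko : k = o
    · exact win_bb fun h => ih _ _ _ _ (by omega) h.swap
    · exact win_bb (ih _ _ _ _ (by omega))
  · intro k' o' hk ho
    exact win_rr (ih _ _ _ _ (by omega))
  · intro k' o' hk ho
    exact win_bb (ih _ _ _ _ (by omega))

theorem not_win_one_zero_of_even {x k o : ℕ}
    (h : 2 ≤ x ∧ x % 2 = 0 ∧ k < o ∧ (k + o) % 2 = 1) :
    ¬ Win (pos [x] k) (pos [] o) := by
  induction hn : k + o using Nat.strong_induction_on generalizing x k o with
  | _ n ih =>
  replace ih (x k o : ℕ) (h : k + o < n ∧ 2 ≤ x ∧ x % 2 = 0 ∧ k < o ∧ (k + o) % 2 = 1) :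
      ¬ Win (pos [x] k) (pos [] o) := ih _ h.1 h.2 rfl
  refine not_win_one_zero h.1 ?_ ?_ ?_ ?_ ?_
  · intro k' hk
    exact win_b11 (o' := o - 2) (h := not_win_one_one_of_odd (by omega))
  · intro k' hk
    exact win_rr (ih _ _ _ (by omega))
  · intro o' ho
    by_cases hk : k = 0
    · exact win_b1 (b := 2) (C := []) (o' := o' - 1) (h := not_win_one_one_of_odd (by omega))
    · exact win_r1 (a := x) (C := []) (k' := k - 1) (h := not_win_one_one_of_odd (by omega))
  · intro k' o' hk ho
    exact win_rr (ih _ _ _ (by omega))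
  · intro k' o' hk ho
    exact win_b1 (b := 2) (C := []) (o' := o' - 1) (h := not_win_one_one_of_odd (by omega))

theorem replicate_one (n : ℕ) : Multiset.replicate n 1 = pos [] n := by simp [pos]

/-- The player to move wins with an odd number of singletons. -/
theorem win_of_odd {p q : ℕ} (hp : 1 ≤ p) (hpq : p ≤ q) (h : (p + q) % 2 = 1) :
    Win (pos [] p) (pos [] q) := by
  obtain rfl | hp2 := hp.eq_or_lt
  · exact win_re (k' := 0) (o' := q - 1) (h := not_win_one_zero_of_even (by omega))
  · exact win_r11 (k' := p - 2) (h := not_win_one_zero_of_even (by omega))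

/-- The player to move wins with at most two singletons of one color. -/
theorem win_of_le_two {p q : ℕ} (hp : 1 ≤ p) (hp2 : p ≤ 2) (hpq : p ≤ q)
    (h : (p + q) % 2 = 0) : Win (pos [] p) (pos [] q) := by
  have mono {A B : List ℕ} {k o : ℕ} (hA : pos A k = 0 := by rfl)
      (hB : (B.length + o) % 2 = 1 := by simp <;> omega) : ¬ Win (pos A k) (pos B o) := by
    rw [hA]
    exact not_win_zero_left (by rwa [card_pos, Nat.odd_iff])
  have mono_win {A B : List ℕ} {k o : ℕ} (hA : pos A k = 0 := by rfl)
      (hB : (B.length + o) % 2 = 0 := by simp <;> omega) (hB0 : B ≠ [] := by simp) :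
      Win (pos A k) (pos B o) := by
    rw [hA]
    refine win_zero_left (by rwa [card_pos, Nat.even_iff]) ?_
    rw [← Multiset.card_pos, card_pos]
    have := List.length_pos_iff.2 hB0
    omega
  obtain rfl | rfl : p = 1 ∨ p = 2 := by omega
  · exact win_be (k' := 0) (o' := q - 1) (h := mono)
  by_cases hq : q = 2
  · subst hq
    refine win_r11 (k' := 0) (h := not_win_one_zero le_rfl (by omega) (by omega) ?_ (by omega)
      (by omega))
    intro o' ho
    obtain rfl : o' = 0 := by omega
    exact win_bE (a := 2) (C := []) (D := []) (h := mono)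
  refine win_be (k' := 1) (o' := q - 1) (h := ?_)
  refine not_win_pos (by simp) (by simp) (by simp [picks]) (by simp [picks]) (by omega)
    (by simp [picks]) ?_ ?_ ?_ ?_ (by simp [picks]) (by simp [picks])
  · simp only [picks, List.map_nil, List.mem_singleton, forall_eq]
    intro o' ho
    exact win_be (k' := 0) (o' := o' - 1) (h := mono)
  · intro o' ho
    exact win_be (k' := 0) (o' := o' - 1) (h := mono)
  · intro k' o' hk ho
    obtain rfl : k' = 0 := by omega
    exact win_bE (a := 2) (C := []) (D := []) (h := mono)
  · intro k' o' hk ho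
    obtain rfl : k' = 0 := by omega
    exact mono_win

/-- The positions `pos [x] k`, `pos [y] o` with an even number of stacks that are won by the
second player. -/
def Balanced (x y k o : ℕ) : Prop :=
  2 ≤ x ∧ 2 ≤ y ∧ (x + y) % 2 = 0 ∧ 2 ≤ k ∧ k ≤ o ∧ (k + o) % 2 = 0 ∧
    (k = 2 → k = o ∨ x + k ≠ y + o)

/-- `Balanced` positions with fewer than `n` singletons are lost. -/
def BalancedBelow (n : ℕ) : Prop :=
  ∀ x y k o, k + o < n ∧ Balanced x y k o → ¬ Win (pos [x] k) (pos [y] o)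

section balanced
variable {x y k k' o o' : ℕ}

theorem Balanced.win_red_grow (h : Balanced x y k o) (ih : BalancedBelow (k + o))
    (hk : k = k' + 1) : Win (pos [x + 1] k') (pos [y] o) := by
  unfold BalancedBelow Balanced at *
  by_cases hgen : 3 < k ∨ k = 3 ∧ (k = o ∨ x + k ≠ y + o)
  · exact win_b1 (b := y) (C := []) (o' := o - 1) (h := ih _ _ _ _ (by omega))
  by_cases hk3 : k = 3
  · exact win_be (k' := 1) (o' := o - 1) (h := not_win_one_two_two)
  obtain rfl : k' = 1 := by omega
  by_cases hy : y = x + 2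
  · by_cases ho : o = 2
    · subst ho
      exact win_b11 (o' := 0) (h := not_win_two_pairs (x + 1) 1 2 y)
    · exact win_be (k' := 0) (o' := o - 1) (h := not_win_pos_singleton)
  by_cases hd : x + k = y + o
  · obtain rfl : o = 2 := by omega
    exact win_re (k' := 0) (o' := 1) (h := not_win_two_pairs 2 (x + 1) y 1)
  · exact win_r1 (a := x + 1) (C := []) (k' := 0) (h := not_win_pos_singleton)

theorem Balanced.win_red_pair (h : Balanced x y k o) (ih : BalancedBelow (k + o))
    (hk : k = k' + 2) : Win (pos [2, x] k') (pos [y] o) := by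
  unfold BalancedBelow Balanced at *
  by_cases hgen : 4 < k ∨ k = 4 ∧ x + k ≠ y + o
  · exact win_rr (ih _ _ _ _ (by omega))
  by_cases hk4 : k = 4
  · by_cases ho : o = 4
    · obtain rfl : y = x := by omega
      exact win_bE (a := y) (C := [2]) (D := []) (h := ih _ _ _ _ (by omega))
    · exact win_be (k' := 1) (o' := o - 1) (h := not_win_two_one_two)
  by_cases hk3 : k = 3
  · obtain rfl : k' = 1 := by omega
    by_cases hxy : y = x
    · subst hxy
      exact win_bE (a := y) (C := [2]) (D := []) (h := not_win_two_one)
    by_cases hd : x + k = y + o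
    · exact win_be (k' := 0) (o' := o - 1) (h := not_win_pair_two_two)
    by_cases hy : y = 2 + x
    · subst hy
      exact win_rr not_win_equal
    by_cases hy3 : y = 3
    · exact win_r1 (a := x) (C := [2]) (k' := 0) (h := not_win_pos_pair (x + 1) 2)
    · exact win_r1 (a := 2) (C := [x]) (k' := 0) (h := not_win_pos_pair 3 x)
  obtain rfl : k' = 0 := by omega
  by_cases hy : y = 2 + x
  · exact win_b1 (b := y) (C := []) (o' := o - 1) (h := not_win_pos_pair 2 x)
  by_cases hd : x + k = y + o
  · obtain rfl : y = x := by omega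
    obtain rfl : o = 2 := by omega
    exact win_rE (a := y) (C := [2]) (D := []) (h := not_win_two_pairs (y + y) 2 1 1)
  · exact win_rr not_win_pos_singleton

theorem Balanced.win_red_eat (h : Balanced x y k o) (ih : BalancedBelow (k + o))
    (hk : k = k' + 1) (ho : o = o' + 1) : Win (pos [2, x] k') (pos [y] o') := by
  unfold BalancedBelow Balanced at *
  by_cases hgen : 3 < k ∨ k = 3 ∧ (k = o ∨ x + 2 + k ≠ y + o)
  · exact win_rr (ih _ _ _ _ (by omega))
  by_cases hk3 : k = 3
  · by_cases hxy : y = x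
    · subst hxy
      exact win_bE (a := y) (C := [2]) (D := []) (h := ih _ _ _ _ (by omega))
    · exact win_be (k' := 1) (o' := o' - 1) (h := not_win_two_one_two)
  obtain rfl : k' = 1 := by omega
  by_cases hxy : y = x
  · subst hxy
    by_cases ho2 : o = 2
    · obtain rfl : o' = 1 := by omega
      exact win_r1 (a := 2) (C := [y]) (k' := 0) (h := not_win_two_pairs 3 y y 1)
    · exact win_bE (a := y) (C := [2]) (D := []) (h := not_win_two_one)
  by_cases hy : y = 2 + x
  · subst hy
    by_cases ho2 : o = 2
    · obtain rfl : o' = 1 := by omega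
      exact win_be (k' := 0) (o' := 0) (h := not_win_two_pairs 2 x 2 (2 + x))
    · exact win_rr not_win_equal
  by_cases hd : x + 2 + k = y + o
  · exact win_be (k' := 0) (o' := o' - 1) (h := not_win_pair_two_two)
  by_cases hy3 : y = 3
  · exact win_r1 (a := x) (C := [2]) (k' := 0) (h := not_win_pos_pair (x + 1) 2)
  · exact win_r1 (a := 2) (C := [x]) (k' := 0) (h := not_win_pos_pair 3 x)

theorem Balanced.win_red_eat_equal (h : Balanced x x k o) (ih : BalancedBelow (k + o)) :
    Win (pos [x + x] k) (pos [] o) := by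
  unfold BalancedBelow Balanced at *
  by_cases hko : k = o
  · by_cases hk : k = 2
    · obtain rfl : o = 2 := by omega
      subst hk
      have single : ¬ Win (pos [2] 0) (pos [x + x] 2) := not_win_pos_singleton
      exact win_b11 (o' := 0) (h := fun h => single h.swap)
    · exact win_be (k' := k - 1) (o' := o - 1) (h := ih _ _ _ _ (by omega))
  by_cases hd : k = 2 ∧ o = x + x + 2
  · obtain ⟨rfl, rfl⟩ := hd
    exact win_be (k' := 1) (o' := x + x + 1) (h := not_win_one_two_of_eq)
  · exact win_b11 (o' := o - 2) (h := ih _ _ _ _ (by omega))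

theorem Balanced.swap (h : Balanced x y k k) : Balanced y x k k := by
  unfold Balanced at *
  omega

theorem Balanced.win_blue_grow (h : Balanced x y k o) (ih : BalancedBelow (k + o))
    (ho : o = o' + 1) : Win (pos [x] k) (pos [y + 1] o') := by
  by_cases hko : k = o
  · subst hko
    exact (h.swap.win_red_grow ih ho).swap
  unfold BalancedBelow Balanced at *
  exact win_b1 (b := y + 1) (C := []) (o' := o' - 1) (h := ih _ _ _ _ (by omega))

theorem Balanced.win_blue_pair (h : Balanced x y k o) (ih : BalancedBelow (k + o))
    (ho : o = o' + 2) : Win (pos [x] k) (pos [2, y] o') := by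
  by_cases hko : k = o
  · subst hko
    exact (h.swap.win_red_pair ih ho).swap
  unfold BalancedBelow Balanced at *
  exact win_bb (ih _ _ _ _ (by omega))

theorem Balanced.win_blue_eat (h : Balanced x y k o) (ih : BalancedBelow (k + o))
    (hk : k = k' + 1) (ho : o = o' + 1) : Win (pos [x] k') (pos [2, y] o') := by
  by_cases hko : k = o
  · subst hko
    exact (h.swap.win_red_eat ih ho hk).swap
  unfold BalancedBelow Balanced at *
  by_cases hgen : 3 < k ∨ k = 3 ∧ x + k ≠ y + o + 2
  · exact win_bb (ih _ _ _ _ (by omega))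
  by_cases hk3 : k = 3
  · exact win_be (k' := 1) (o' := o' - 1) (h := not_win_one_two_two_two)
  by_cases hd : x + k = y + o + 2
  · exact win_be (k' := 0) (o' := o' - 1) (h := not_win_pos_singleton)
  · exact win_r1 (a := x) (C := []) (k' := 0) (h := not_win_pos_singleton)

theorem Balanced.win_blue_eat_equal (h : Balanced x x k o) (ih : BalancedBelow (k + o)) :
    Win (pos [] k) (pos [x + x] o) := by
  unfold BalancedBelow Balanced at *
  by_cases hk : k = 2
  · exact win_r11 (k' := 0) (h := not_win_pos_singleton)
  · exact win_re (k' := k - 1) (o' := o - 1) (h := ih _ _ _ _ (by omega))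

theorem Balanced.not_win (h : Balanced x y k o) : ¬ Win (pos [x] k) (pos [y] o) := by
  induction hn : k + o using Nat.strong_induction_on generalizing x y k o with
  | _ n ih =>
  subst hn
  replace ih : BalancedBelow (k + o) := fun _ _ _ _ h => ih _ h.1 h.2 rfl
  refine not_win_one_one h.1 h.2.1 (fun _ => h.win_red_grow ih) (fun _ => h.win_red_pair ih)
    (fun _ => h.win_blue_grow ih) (fun _ => h.win_blue_pair ih) (fun _ _ => h.win_red_eat ih)
    (fun _ _ => h.win_blue_eat ih) ?_ ?_
  · rintro rfl
    exact h.win_red_eat_equal ih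
  · rintro rfl
    exact h.win_blue_eat_equal ih

end balanced

theorem not_win_of_even {p q : ℕ} (hp : 3 ≤ p) (hpq : p ≤ q) (h : (p + q) % 2 = 0) :
    ¬ Win (pos [] p) (pos [] q) := by
  have shape {k o : ℕ} (r11 : ∀ k', k = k' + 2 → Win (pos [2] k') (pos [] o))
      (b11 : ∀ o', o = o' + 2 → Win (pos [] k) (pos [2] o'))
      (re : ∀ k' o', k = k' + 1 → o = o' + 1 → Win (pos [2] k') (pos [] o'))
      (be : ∀ k' o', k = k' + 1 → o = o' + 1 → Win (pos [] k') (pos [2] o')) :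
      ¬ Win (pos [] k) (pos [] o) :=
    not_win_pos (by simp) (by simp) (by simp [picks]) (by simp [picks]) r11
      (by simp [picks]) (by simp [picks]) b11 re be (by simp [picks]) (by simp [picks])
  by_cases hq : q = 3
  · obtain rfl : p = 3 := by omega
    subst hq
    have base : ¬ Win (pos [2, 2] 0) (pos [] 2) := not_win_pos_pair 2 2
    have merge : Win (pos [2] 1) (pos [] 3) := win_re (k' := 0) (o' := 2) (h := base)
    have eat : Win (pos [2] 2) (pos [] 2) := win_r11 (k' := 0) (h := base)
    refine shape ?_ ?_ ?_ ?_
    · intro k' hk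
      obtain rfl : k' = 1 := by omega
      exact merge
    · intro o' ho
      obtain rfl : o' = 1 := by omega
      exact merge.swap
    · intro k' o' hk ho
      obtain rfl : k' = 2 := by omega
      obtain rfl : o' = 2 := by omega
      exact eat
    · intro k' o' hk ho
      obtain rfl : k' = 2 := by omega
      obtain rfl : o' = 2 := by omega
      exact eat.swap
  have target : ¬ Win (pos [2] (p - 2)) (pos [2] (q - 2)) := by
    by_cases hp3 : p = 3
    · subst hp3
      exact not_win_equal
    · refine Balanced.not_win ?_
      unfold Balanced
      omega
  refine shape ?_ ?_ ?_ ?_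
  · rintro k' rfl
    exact win_b11 (o' := q - 2) (h := target)
  · rintro o' rfl
    exact win_r11 (k' := p - 2) (h := target)
  · rintro k' o' hk ho
    exact win_be (k' := p - 2) (o' := q - 2) (h := target)
  · rintro k' o' hk ho
    exact win_re (k' := p - 2) (o' := q - 2) (h := target)

end Babylon

/-- Two-color Babylon with `p` chips of one color and `q` of the other,
`1 ≤ p ≤ q`, is a win for the second player iff `p + q` is even and `p ≥ 3`;
equivalently, it is a first-player win iff `p + q` is odd or `p ≤ 2`. -/
theorem babylon_classification (p q : ℕ) (hp : 1 ≤ p) (hpq : p ≤ q) :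
    (¬ FirstWin (initPos p q) ↔ Even (p + q) ∧ 3 ≤ p) ∧
    (FirstWin (initPos p q) ↔ Odd (p + q) ∨ p ≤ 2) := by
  have main : FirstWin (initPos p q) ↔ Odd (p + q) ∨ p ≤ 2 := by
    rw [Babylon.firstWin_initPos_iff, Babylon.replicate_one, Babylon.replicate_one, Nat.odd_iff]
    by_cases h : (p + q) % 2 = 1
    · simp [h, Babylon.win_of_odd hp hpq h]
    by_cases hp2 : p ≤ 2
    · simp [hp2, Babylon.win_of_le_two hp hp2 hpq (by omega)]
    · simp [h, hp2, Babylon.not_win_of_even (by omega) hpq (by omega)]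
  refine ⟨?_, main⟩
  rw [main, not_or, Nat.not_odd_iff_even, not_le]
  rfl
end

section
/- Any two-color Babylon position consisting of 3 red singleton stacks, k blue singleton stacks with k ≥ 4 even (so the total number of stacks, k+5, is odd), exactly one red stack of height 2u+1 with u ≥ 1, and exactly one blue stack of height 2v with v ≥ 1, is a first-player win; that is, the player to move wins with best play. -/
/-- The heights of the stacks of color `c`. -/
def heights (c : Bool) (P : Position) : Multiset ℕ :=
  (P.filter (fun s => s.head? = some c)).map List.length

/-- The moves of the game seen on the heights `R` of the red stacks and `B` of the blue stacks. -/
inductive HMove : Multiset ℕ → Multiset ℕ → Multiset ℕ → Multiset ℕ → Prop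
  | red (x y : ℕ) (R B : Multiset ℕ) : HMove (x ::ₘ y ::ₘ R) B ((x + y) ::ₘ R) B
  | blue (x y : ℕ) (R B : Multiset ℕ) : HMove R (x ::ₘ y ::ₘ B) R ((x + y) ::ₘ B)
  | toRed (x : ℕ) (R B : Multiset ℕ) : HMove (x ::ₘ R) (x ::ₘ B) ((x + x) ::ₘ R) B
  | toBlue (x : ℕ) (R B : Multiset ℕ) : HMove (x ::ₘ R) (x ::ₘ B) R ((x + x) ::ₘ B)

/-- Every position with these heights is a first-player win. -/
def HWin (R B : Multiset ℕ) : Prop :=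
  ∀ P : Position, (∀ s ∈ P, s ≠ []) → heights true P = R → heights false P = B → FirstWin P

/-- No position with these heights is a first-player win. -/
def HLose (R B : Multiset ℕ) : Prop :=
  ∀ P : Position, (∀ s ∈ P, s ≠ []) → heights true P = R → heights false P = B → ¬ FirstWin P

theorem heights_cons_self {c : Bool} {s : Stack} (h : s.head? = some c) (P : Position) :
    heights c (s ::ₘ P) = s.length ::ₘ heights c P := by
  simp [heights, h]

theorem heights_cons_ne {c : Bool} {s : Stack} (h : s.head? ≠ some c) (P : Position) :
    heights c (s ::ₘ P) = heights c P := by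
  simp [heights, h]

theorem exists_cons_of_heights {c d : Bool} (hcd : c ≠ d) {P : Position} {x : ℕ} {H : Multiset ℕ}
    (h : heights c P = x ::ₘ H) :
    ∃ s P', P = s ::ₘ P' ∧ s.head? = some c ∧ s.length = x ∧ heights c P' = H ∧
      heights d P' = heights d P := by
  have hx : x ∈ heights c P := by simp [h]
  obtain ⟨s, hs, rfl⟩ := Multiset.mem_map.1 hx
  obtain ⟨hsP, hc⟩ := Multiset.mem_filter.1 hs
  obtain ⟨P', rfl⟩ := Multiset.exists_cons_of_mem hsP
  rw [heights_cons_self hc, Multiset.cons_inj_right] at h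
  exact ⟨s, P', rfl, hc, rfl, h, (heights_cons_ne (by simp [hc, hcd]) _).symm⟩

theorem head?_append_of_head? {c : Bool} {s t : Stack} (h : s.head? = some c) :
    (s ++ t).head? = some c := by
  cases s <;> simp_all

theorem move_cons_cons {s t : Stack} {P : Position} (hs : s ≠ []) (ht : t ≠ [])
    (h : s.length = t.length ∨ s.head? = t.head?) :
    Move (s ::ₘ t ::ₘ P) ((s ++ t) ::ₘ P) :=
  ⟨s, t, hs, ht, by simp, by simp, h, by simp⟩

theorem Move.exists_cons_cons {P Q : Position} (h : Move P Q) :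
    ∃ s t P', s ≠ [] ∧ t ≠ [] ∧ (s.length = t.length ∨ s.head? = t.head?) ∧
      P = s ::ₘ t ::ₘ P' ∧ Q = (s ++ t) ::ₘ P' := by
  obtain ⟨s, t, hs, ht, hsP, htP, h, rfl⟩ := h
  exact ⟨s, t, _, hs, ht, h, by rw [Multiset.cons_erase htP, Multiset.cons_erase hsP], rfl⟩

theorem Move.card_eq {P Q : Position} (h : Move P Q) :
    Multiset.card P = Multiset.card Q + 1 := by
  obtain ⟨s, t, P', -, -, -, rfl, rfl⟩ := h.exists_cons_cons
  simp

theorem firstWin_iff (P : Position) : FirstWin P ↔ ∃ Q, Move P Q ∧ ¬ FirstWin Q := by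
  unfold FirstWin
  constructor
  · cases h : Multiset.card P with
    | zero => simp [FirstWinAux]
    | succ n =>
      rintro ⟨Q, hQ, hn⟩
      have := hQ.card_eq
      obtain rfl : Multiset.card Q = n := by omega
      exact ⟨Q, hQ, hn⟩
  · rintro ⟨Q, hQ, hn⟩
    rw [hQ.card_eq]
    exact ⟨Q, hQ, hn⟩

theorem head?_eq_true_or_false {s : Stack} (hs : s ≠ []) :
    s.head? = some true ∨ s.head? = some false := by
  rcases s with _ | ⟨_ | _, s⟩ <;> simp_all

theorem Move.hMove {P Q : Position} (h : Move P Q) :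
    HMove (heights true P) (heights false P) (heights true Q) (heights false Q) := by
  obtain ⟨s, t, P', hs, ht, hst, rfl, rfl⟩ := h.exists_cons_cons
  rcases head?_eq_true_or_false hs with hs' | hs' <;>
    rcases head?_eq_true_or_false ht with ht' | ht' <;>
    simp only [hs', ht', heights_cons_self, heights_cons_ne, head?_append_of_head? hs', ne_eq,
      Option.some.injEq, Bool.true_eq_false, Bool.false_eq_true, not_false_eq_true, or_false,
      List.length_append] at hst ⊢
  · exact HMove.red ..
  · rw [hst]; exact HMove.toRed ..
  · rw [hst]; exact HMove.toBlue ..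
  · exact HMove.blue ..

theorem HMove.exists_move {P : Position} {R' B' : Multiset ℕ}
    (h : HMove (heights true P) (heights false P) R' B') (hP : ∀ s ∈ P, s ≠ []) :
    ∃ Q, Move P Q ∧ (∀ s ∈ Q, s ≠ []) ∧ heights true Q = R' ∧ heights false Q = B' := by
  have ne {s t : Stack} {P' : Position} (h : P = s ::ₘ t ::ₘ P') :
      s ≠ [] ∧ t ≠ [] ∧ ∀ r ∈ (s ++ t) ::ₘ P', r ≠ [] := by
    subst h
    simp only [Multiset.mem_cons, forall_eq_or_imp] at hP ⊢
    exact ⟨hP.1, hP.2.1, by simp [hP.1], hP.2.2⟩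
  generalize hR : heights true P = R, hB : heights false P = B at h
  cases h with
  | red x y R =>
    obtain ⟨s, P1, rfl, hs, rfl, h1, h1'⟩ := exists_cons_of_heights (d := false) (by decide) hR
    obtain ⟨t, P2, rfl, ht, rfl, h2, h2'⟩ :=
      exists_cons_of_heights (d := false) (by decide) h1
    obtain ⟨hsn, htn, hQ⟩ := ne rfl
    refine ⟨_, move_cons_cons hsn htn (.inr (hs.trans ht.symm)), hQ, ?_, ?_⟩
    · rw [heights_cons_self (head?_append_of_head? hs), h2, List.length_append]
    · rw [heights_cons_ne (by simp [head?_append_of_head? hs]), ← hB, ← h1', ← h2']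
  | blue x y _ B =>
    obtain ⟨s, P1, rfl, hs, rfl, h1, h1'⟩ := exists_cons_of_heights (d := true) (by decide) hB
    obtain ⟨t, P2, rfl, ht, rfl, h2, h2'⟩ :=
      exists_cons_of_heights (d := true) (by decide) h1
    obtain ⟨hsn, htn, hQ⟩ := ne rfl
    refine ⟨_, move_cons_cons hsn htn (.inr (hs.trans ht.symm)), hQ, ?_, ?_⟩
    · rw [heights_cons_ne (by simp [head?_append_of_head? hs]), ← hR, ← h1', ← h2']
    · rw [heights_cons_self (head?_append_of_head? hs), h2, List.length_append]
  | toRed x R B =>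
    obtain ⟨s, P1, rfl, hs, rfl, h1, h1'⟩ := exists_cons_of_heights (d := false) (by decide) hR
    obtain ⟨t, P2, rfl, ht, hl, h2, h2'⟩ :=
      exists_cons_of_heights (d := true) (by decide) (h1'.trans hB)
    obtain ⟨hsn, htn, hQ⟩ := ne rfl
    refine ⟨_, move_cons_cons hsn htn (.inl hl.symm), hQ, ?_, ?_⟩
    · rw [heights_cons_self (head?_append_of_head? hs), List.length_append, hl, ← h1, ← h2']
    · rw [heights_cons_ne (by simp [head?_append_of_head? hs]), ← h2]
  | toBlue x R B =>
    obtain ⟨s, P1, rfl, hs, rfl, h1, h1'⟩ := exists_cons_of_heights (d := true) (by decide) hB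
    obtain ⟨t, P2, rfl, ht, hl, h2, h2'⟩ :=
      exists_cons_of_heights (d := false) (by decide) (h1'.trans hR)
    obtain ⟨hsn, htn, hQ⟩ := ne rfl
    refine ⟨_, move_cons_cons hsn htn (.inl hl.symm), hQ, ?_, ?_⟩
    · rw [heights_cons_ne (by simp [head?_append_of_head? hs]), ← h2]
    · rw [heights_cons_self (head?_append_of_head? hs), List.length_append, hl, ← h1, ← h2']

theorem HLose.of_forall {R B : Multiset ℕ} (h : ∀ R' B', HMove R B R' B' → HWin R' B') :
    HLose R B := by
  rintro P hP rfl rfl hw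
  obtain ⟨Q, hQ, hn⟩ := (firstWin_iff P).1 hw
  refine hn (h _ _ hQ.hMove Q ?_ rfl rfl)
  obtain ⟨s, t, P', hs, -, -, rfl, rfl⟩ := hQ.exists_cons_cons
  simp only [Multiset.mem_cons, forall_eq_or_imp] at hP ⊢
  exact ⟨by simp [hs], hP.2.2⟩

theorem HLose.hWin_of_hMove {R B R' B' : Multiset ℕ} (hl : HLose R' B') (h : HMove R B R' B') :
    HWin R B := by
  rintro P hP rfl rfl
  obtain ⟨Q, hQ, hQn, hR, hB⟩ := h.exists_move hP
  exact (firstWin_iff P).2 ⟨Q, hQ, hl Q hQn hR hB⟩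

/-- A red height `c` is good, relative to the total height `T` and the heights `B` of the blue
stacks, if the blue stacks can be prevented from ending up in a single stack of height `c`. -/
def Good (c T : ℕ) (B : Multiset ℕ) : Prop :=
  2 * c ≠ T ∧ (Odd c ∨ ¬ c ∣ T ∨ ∃ x ∈ B, c < 2 * x)

theorem Good.merge {c T x y : ℕ} {B : Multiset ℕ} (h : Good c T (x ::ₘ y ::ₘ B)) :
    Good c T ((x + y) ::ₘ B) := by
  obtain ⟨h1, h2⟩ := h
  refine ⟨h1, h2.imp_right (Or.imp_right ?_)⟩
  rintro ⟨z, hz, hc⟩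
  simp only [Multiset.mem_cons] at hz
  rcases hz with rfl | rfl | hz
  · exact ⟨z + y, by simp, by omega⟩
  · exact ⟨x + z, by simp, by omega⟩
  · exact ⟨z, by simp [hz], hc⟩

theorem Good.of_odd {c T : ℕ} {B : Multiset ℕ} (h : 2 * c ≠ T) (hc : Odd c) : Good c T B :=
  ⟨h, .inl hc⟩

theorem Good.of_not_dvd {c T : ℕ} {B : Multiset ℕ} (h : ¬ c ∣ T) : Good c T B :=
  ⟨fun h' => h ⟨2, by omega⟩, .inr (.inl h)⟩

theorem Good.of_mem {c T x : ℕ} {B : Multiset ℕ} (h : 2 * c ≠ T) (hx : x ∈ B) (hc : c < 2 * x) :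
    Good c T B :=
  ⟨h, .inr (.inr ⟨x, hx, hc⟩)⟩

theorem hLose_singleton_of_forall {r : ℕ} {B : Multiset ℕ} (hr : r ∉ B)
    (h : ∀ x y B', B = x ::ₘ y ::ₘ B' → HWin {r} ((x + y) ::ₘ B')) : HLose {r} B := by
  refine HLose.of_forall fun R' B' hm => ?_
  generalize hR : ({r} : Multiset ℕ) = R at hm
  cases hm with
  | red x y R => simpa using congrArg Multiset.card hR
  | blue x y _ B => subst hR; exact h x y B rfl
  | toRed x R B =>
    have : x = r := by simpa [← hR] using Multiset.mem_cons_self x R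
    simp [← this] at hr
  | toBlue x R B =>
    have : x = r := by simpa [← hR] using Multiset.mem_cons_self x R'
    simp [← this] at hr

theorem hLose_pair_of_forall {a b : ℕ} {B : Multiset ℕ} (hred : HWin {a + b} B)
    (hblue : ∀ x y B', B = x ::ₘ y ::ₘ B' → HWin {a, b} ((x + y) ::ₘ B'))
    (ha : ∀ B', B = a ::ₘ B' → HWin {b} ((a + a) ::ₘ B') ∧ HWin {a + a, b} B')
    (hb : ∀ B', B = b ::ₘ B' → HWin {a} ((b + b) ::ₘ B') ∧ HWin {b + b, a} B') :
    HLose {a, b} B := by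
  refine HLose.of_forall fun R' B' hm => ?_
  have key {x : ℕ} {R : Multiset ℕ} (h : ({a, b} : Multiset ℕ) = x ::ₘ R) :
      x = a ∧ R = {b} ∨ x = b ∧ R = {a} := by
    have hx : x ∈ ({a, b} : Multiset ℕ) := by simp [h]
    simp only [Multiset.insert_eq_cons, Multiset.mem_cons, Multiset.mem_singleton] at hx
    rcases hx with rfl | rfl
    · left; simpa [eq_comm] using h
    · right
      rw [Multiset.pair_comm] at h
      simpa [eq_comm] using h
  generalize hR : ({a, b} : Multiset ℕ) = R at hm
  cases hm with
  | red x y R =>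
    rcases key hR with ⟨rfl, h⟩ | ⟨rfl, h⟩ <;>
      obtain ⟨rfl, rfl⟩ := (Multiset.singleton_eq_cons_iff _).1 h.symm
    · exact hred
    · rw [add_comm]; exact hred
  | blue x y _ B => subst hR; exact hblue x y B rfl
  | toRed x R B =>
    rcases key hR with ⟨rfl, rfl⟩ | ⟨rfl, rfl⟩
    · exact (ha _ rfl).2
    · exact (hb _ rfl).2
  | toBlue x R B =>
    rcases key hR with ⟨rfl, rfl⟩ | ⟨rfl, rfl⟩
    · exact (ha _ rfl).1
    · exact (hb _ rfl).1

theorem hWin_singleton_of_hLose {r T : ℕ} {B : Multiset ℕ}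
    (hcard : Even (Multiset.card B)) (hT : r + B.sum = T) (h0 : B ≠ 0) (hpos : ∀ x ∈ B, 0 < x)
    (hcount : B.count r ≤ 1) (hgood : Good r T B)
    (ih : ∀ x y B', B = x ::ₘ y ::ₘ B' → r ≠ x + y → r ∉ B' → Good r T ((x + y) ::ₘ B') →
      HLose {r} ((x + y) ::ₘ B')) : HWin {r} B := by
  have main (x y : ℕ) (B' : Multiset ℕ) (h : B = x ::ₘ y ::ₘ B') (h1 : r ≠ x + y) (h2 : r ∉ B')
      (hg : Good r T ((x + y) ::ₘ B')) : HWin {r} B := by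
    subst h
    exact (ih x y B' rfl h1 h2 hg).hWin_of_hMove (HMove.blue ..)
  have two {x : ℕ} {C : Multiset ℕ} (h : B = x ::ₘ C) : ∃ y D, C = y ::ₘ D := by
    subst h
    obtain rfl | hC := eq_or_ne C 0
    · simp at hcard
    · obtain ⟨y, hy⟩ := Multiset.exists_mem_of_ne_zero hC
      exact ⟨y, Multiset.exists_cons_of_mem hy⟩
  by_cases hrB : r ∈ B
  · obtain ⟨C, hC⟩ := Multiset.exists_cons_of_mem hrB
    obtain ⟨y, D, rfl⟩ := two hC
    subst hC
    have hy := hpos y (by simp)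
    refine main r y D rfl (by omega) ?_ (.of_mem hgood.1 (Multiset.mem_cons_self _ _) (by omega))
    intro h
    have := Multiset.one_le_count_iff_mem.2 h
    rw [Multiset.count_cons_self, Multiset.count_cons] at hcount
    omega
  · by_cases hp : ∃ x y C, B = x ::ₘ y ::ₘ C ∧ r ≠ x + y
    · obtain ⟨x, y, C, rfl, hxy⟩ := hp
      exact main x y C rfl hxy (by simp at hrB; tauto) hgood.merge
    · push Not at hp
      exfalso
      obtain ⟨x, hx⟩ := Multiset.exists_mem_of_ne_zero h0
      obtain ⟨C, rfl⟩ := Multiset.exists_cons_of_mem hx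
      obtain ⟨y, D, rfl⟩ := two rfl
      have hD : ∀ z ∈ D, z = y := by
        intro z hz
        obtain ⟨E, rfl⟩ := Multiset.exists_cons_of_mem hz
        have h1 := hp x y _ rfl
        have h2 := hp x z (y ::ₘ E) (by rw [Multiset.cons_swap y])
        omega
      have hrxy := hp x y D rfl
      obtain ⟨n, rfl⟩ : ∃ n, D = Multiset.replicate n y := ⟨_, Multiset.eq_replicate_card.2 hD⟩
      obtain ⟨hT', hgood⟩ := hgood
      rcases n with _ | n
      · simp at hT; omega
      · have := hp y y (x ::ₘ Multiset.replicate n y) (by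
          simp only [Multiset.replicate_succ, ← Multiset.singleton_add]; abel)
        obtain rfl : x = y := by omega
        rcases hgood with ⟨m, hm⟩ | h | ⟨z, hz, h⟩
        · omega
        · obtain ⟨m, hm⟩ := hcard
          refine h ⟨m + 1, ?_⟩
          simp only [Multiset.card_cons, Multiset.card_replicate, Multiset.sum_cons,
            Multiset.sum_replicate, smul_eq_mul] at hm hT
          rw [← hT, hrxy]
          have := congrArg (· * x) hm
          linarith
        · obtain rfl : z = x := by simp [Multiset.mem_replicate] at hz; tauto
          omega

theorem hLose_singleton {r T : ℕ} : ∀ {B : Multiset ℕ}, Odd (Multiset.card B) →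
    r + B.sum = T → (∀ x ∈ B, 0 < x) → r ∉ B → Good r T B → HLose {r} B := by
  intro B
  induction hn : Multiset.card B using Nat.strong_induction_on generalizing B with
  | _ n IH =>
    intro hcard hT hpos hrB hgood
    subst hn
    refine hLose_singleton_of_forall hrB ?_
    rintro x y B' rfl
    simp only [Multiset.card_cons, Multiset.mem_cons, not_or, forall_eq_or_imp,
      Multiset.sum_cons] at *
    refine hWin_singleton_of_hLose (T := T) (by simp; grind) (by simp; omega) (by simp)
      (by simp; grind) ?_ hgood.merge ?_
    · rw [Multiset.count_cons, Multiset.count_eq_zero.2 (by tauto)]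
      split <;> simp
    · intro z w C hC h1 h2 hg
      have hc := congrArg Multiset.card hC
      have hs := congrArg Multiset.sum hC
      simp only [Multiset.card_cons, Multiset.sum_cons] at hc hs
      have hp : ∀ v ∈ z ::ₘ w ::ₘ C, 0 < v := by rw [← hC]; simp; grind
      simp only [Multiset.mem_cons, forall_eq_or_imp] at hp
      refine IH _ ?_ rfl ?_ ?_ ?_ ?_ hg
      · simp; omega
      · simp; grind
      · simp; omega
      · simp; grind
      · simp [h1, h2]

theorem hWin_singleton {r T : ℕ} {B : Multiset ℕ}
    (hcard : Even (Multiset.card B)) (hT : r + B.sum = T) (h0 : B ≠ 0) (hpos : ∀ x ∈ B, 0 < x)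
    (hcount : B.count r ≤ 1) (hgood : Good r T B) : HWin {r} B := by
  refine hWin_singleton_of_hLose hcard hT h0 hpos hcount hgood ?_
  rintro x y B' rfl h1 h2 hg
  simp only [Multiset.card_cons, Multiset.mem_cons, forall_eq_or_imp, Multiset.sum_cons] at *
  refine hLose_singleton ?_ ?_ ?_ ?_ hg
  · simp; grind
  · simp; omega
  · simp; grind
  · simp [h1, h2]

theorem hWin_pair_of_red {a b T : ℕ} {B : Multiset ℕ}
    (hcard : Odd (Multiset.card B)) (hT : a + b + B.sum = T) (hpos : ∀ x ∈ B, 0 < x)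
    (hB : a + b ∉ B) (hgood : Good (a + b) T B) : HWin {a, b} B :=
  (hLose_singleton hcard hT hpos hB hgood).hWin_of_hMove (HMove.red a b 0 B)

theorem hWin_pair_of_toBlue {a b T : ℕ} {B : Multiset ℕ}
    (hcard : Even (Multiset.card B)) (hT : b + (a + a + B.sum) = T) (hpos : ∀ x ∈ B, 0 < x)
    (ha : 0 < a) (hB : b ∉ B) (hab : b ≠ a + a) (hgood : Good b T ((a + a) ::ₘ B)) :
    HWin {a, b} (a ::ₘ B) := by
  refine (hLose_singleton ?_ ?_ ?_ ?_ hgood).hWin_of_hMove (HMove.toBlue a {b} B)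
  · simpa using hcard.add_one
  · simpa using hT
  · simp; grind
  · simp [hab, hB]

theorem hLose_pair {a b T : ℕ} (ha : 0 < a) (hb : 0 < b) : ∀ {B : Multiset ℕ},
    Even (Multiset.card B) → a + b + B.sum = T → B ≠ 0 → (∀ x ∈ B, 0 < x) → a ∉ B → b ∉ B →
    B.count (a + b) ≤ 1 → Good (a + b) T B → HLose {a, b} B := by
  intro B
  induction hn : Multiset.card B using Nat.strong_induction_on generalizing B with
  | _ n IH =>
    intro hcard hT h0 hpos haB hbB hcount hgood
    subst hn
    refine hLose_pair_of_forall
      (hWin_singleton hcard hT h0 hpos hcount hgood) ?_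
      (by rintro B' rfl; simp at haB) (by rintro B' rfl; simp at hbB)
    rintro x y B' rfl
    simp only [Multiset.card_cons, Multiset.mem_cons, not_or, forall_eq_or_imp,
      Multiset.sum_cons] at hcard hT hpos haB hbB IH
    by_cases hr : a + b ∈ (x + y) ::ₘ B'
    · obtain ⟨w, C, rfl, hC, hle⟩ : ∃ w C, B' = w ::ₘ C ∧ a + b ∉ C ∧ a + b < x + y + w := by
        by_cases hr' : a + b ∈ B'
        · obtain ⟨C, rfl⟩ := Multiset.exists_cons_of_mem hr'
          refine ⟨_, C, rfl, fun h => ?_, by omega⟩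
          have h1 := Multiset.one_le_count_iff_mem.2 h
          have h2 := (Multiset.count_le_count_cons (a + b) x (y ::ₘ (a + b) ::ₘ C))
          have h3 := (Multiset.count_le_count_cons (a + b) y ((a + b) ::ₘ C))
          rw [Multiset.count_cons_self] at h3
          omega
        · obtain rfl | hB' := eq_or_ne B' 0
          · simp at hr hT
            exact absurd hT (by have := hgood.1; omega)
          · obtain ⟨w, hw⟩ := Multiset.exists_mem_of_ne_zero hB'
            obtain ⟨C, rfl⟩ := Multiset.exists_cons_of_mem hw
            have := hpos.2.2 w hw
            have := (Multiset.mem_cons.1 hr).resolve_right hr'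
            exact ⟨w, C, rfl, fun h => hr' (Multiset.mem_cons_of_mem h), by omega⟩
      refine HLose.hWin_of_hMove ?_ (HMove.blue (x + y) w _ C)
      simp only [Multiset.card_cons, Multiset.mem_cons, not_or, forall_eq_or_imp,
        Multiset.sum_cons] at hcard hT hpos haB hbB IH
      refine IH _ ?_ rfl ?_ ?_ ?_ ?_ ?_ ?_ ?_ ?_
      · simp
      · simp; grind
      · simp; omega
      · simp
      · simp; grind
      · simp only [Multiset.mem_cons, not_or]; exact ⟨by omega, haB.2.2.2⟩
      · simp only [Multiset.mem_cons, not_or]; exact ⟨by omega, hbB.2.2.2⟩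
      · rw [Multiset.count_eq_zero.2]
        · simp
        · simp only [Multiset.mem_cons, not_or]; exact ⟨by omega, hC⟩
      · exact .of_mem hgood.1 (Multiset.mem_cons_self _ _) (by omega)
    · refine hWin_pair_of_red ?_ ?_ ?_ hr hgood.merge
      · simp; grind
      · simp; omega
      · simp; grind

theorem hLose_pair_of_cross {a b T : ℕ} {B : Multiset ℕ} (ha : 0 < a) (hb : 0 < b)
    (hcard : Even (Multiset.card B)) (hT : a + b + B.sum = T) (h0 : B ≠ 0)
    (hpos : ∀ x ∈ B, 0 < x) (hr : a + b ∉ B) (hgood : Good (a + b) T B)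
    (hboth : ∀ x y B', B = x ::ₘ y ::ₘ B' → x + y = a + b → a ∈ B' → b ∉ B')
    (hac : ∀ B', B = a ::ₘ B' → b ≠ a + a ∧ 2 * b ≠ T ∧
      HWin {b} ((a + a) ::ₘ B') ∧ HWin {a + a, b} B')
    (hbc : ∀ B', B = b ::ₘ B' → a ≠ b + b ∧ 2 * a ≠ T ∧
      HWin {a} ((b + b) ::ₘ B') ∧ HWin {b + b, a} B') :
    HLose {a, b} B := by
  refine hLose_pair_of_forall (hWin_singleton hcard hT h0 hpos
    (by rw [Multiset.count_eq_zero.2 hr]; simp) hgood) ?_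
    (fun B' h => (hac B' h).2.2) (fun B' h => (hbc B' h).2.2)
  rintro x y B' rfl
  have hgood' := hgood.merge
  simp only [Multiset.card_cons, Multiset.mem_cons, not_or, forall_eq_or_imp,
    Multiset.sum_cons] at hcard hT hpos hr
  by_cases hxy : a + b = x + y
  · have hcross {c d : ℕ} (hcd : c + d = x + y) (hc : 0 < c) (hd : 0 < d) (hcB : c ∈ B')
        (hdB : d ∉ B') (hne : d ≠ c + c) (hdT : 2 * d ≠ T) :
        HWin {c, d} ((x + y) ::ₘ B') := by
      obtain ⟨C, rfl⟩ := Multiset.exists_cons_of_mem hcB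
      rw [Multiset.cons_swap]
      simp only [Multiset.card_cons, Multiset.mem_cons, not_or, forall_eq_or_imp,
        Multiset.sum_cons] at hcard hT hpos hdB
      refine hWin_pair_of_toBlue (T := T) ?_ ?_ ?_ hc ?_ hne
        (.of_mem (x := x + y) hdT (by simp) (by omega))
      · simp; grind
      · simp; omega
      · simp; grind
      · simp only [Multiset.mem_cons, not_or]; exact ⟨by omega, hdB.2⟩
    by_cases haB : a ∈ B'
    · obtain ⟨C, hC⟩ := Multiset.exists_cons_of_mem haB
      obtain ⟨h1, h2, -⟩ := hac (x ::ₘ y ::ₘ C) (by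
        rw [hC, Multiset.cons_swap y, Multiset.cons_swap x])
      exact hcross hxy ha hb haB (hboth x y B' rfl hxy.symm haB) h1 h2
    by_cases hbB : b ∈ B'
    · obtain ⟨C, hC⟩ := Multiset.exists_cons_of_mem hbB
      obtain ⟨h1, h2, -⟩ := hbc (x ::ₘ y ::ₘ C) (by
        rw [hC, Multiset.cons_swap y, Multiset.cons_swap x])
      rw [Multiset.pair_comm]
      exact hcross (by omega) hb ha hbB haB h1 h2
    obtain rfl | hB' := eq_or_ne B' 0
    · simp at hT
      exact absurd hT (by have := hgood.1; omega)
    obtain ⟨w, hw⟩ := Multiset.exists_mem_of_ne_zero hB'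
    obtain ⟨C, rfl⟩ := Multiset.exists_cons_of_mem hw
    refine HLose.hWin_of_hMove ?_ (HMove.blue (x + y) w _ C)
    simp only [Multiset.card_cons, Multiset.mem_cons, not_or, forall_eq_or_imp,
      Multiset.sum_cons] at hcard hT hpos hr haB hbB
    refine hLose_pair (T := T) ha hb ?_ ?_ ?_ ?_ ?_ ?_ ?_ ?_
    · simp; grind
    · simp; omega
    · simp
    · simp; grind
    · simp only [Multiset.mem_cons, not_or]; exact ⟨by omega, haB.2⟩
    · simp only [Multiset.mem_cons, not_or]; exact ⟨by omega, hbB.2⟩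
    · rw [Multiset.count_eq_zero.2]
      · simp
      · simp only [Multiset.mem_cons, not_or]; exact ⟨by omega, hr.2.2.2⟩
    · exact .of_mem hgood.1 (Multiset.mem_cons_self _ _) (by omega)
  · refine hWin_pair_of_red ?_ ?_ ?_ ?_ hgood'
    · simp; grind
    · simp; omega
    · simp; grind
    · simp [hxy, hr]

theorem Good.of_cons {c T a : ℕ} {B : Multiset ℕ} (h : Good c T (a ::ₘ B)) :
    Good c T ((a + a) ::ₘ B) := by
  obtain ⟨h1, h2⟩ := h
  refine ⟨h1, h2.imp_right (Or.imp_right ?_)⟩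
  rintro ⟨z, hz, hc⟩
  simp only [Multiset.mem_cons] at hz
  rcases hz with rfl | hz
  · exact ⟨z + z, by simp, by omega⟩
  · exact ⟨z, by simp [hz], hc⟩

theorem hLose_pair_of_notMem {a b T : ℕ} {B : Multiset ℕ} (ha : 0 < a) (hb : 0 < b)
    (hcard : Even (Multiset.card B)) (hT : a + b + B.sum = T) (h0 : B ≠ 0)
    (hpos : ∀ x ∈ B, 0 < x) (hr : a + b ∉ B) (hgood : Good (a + b) T B) (hbB : b ∉ B)
    (hab : b ≠ a + a) (hgb : a ∈ B → Good b T B)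
    (h : a ∈ B → (a + a + b ∉ B ∧ Good (a + a + b) T B) ∨
      (a + a ∈ B ∧ b ≠ a + a + (a + a))) : HLose {a, b} B := by
  refine hLose_pair_of_cross ha hb hcard hT h0 hpos hr hgood ?_ ?_ ?_
  · rintro x y B' rfl - -
    simp at hbB; tauto
  · rintro B' rfl
    replace hgb := hgb (Multiset.mem_cons_self _ _)
    replace h := h (Multiset.mem_cons_self _ _)
    simp only [Multiset.card_cons, Multiset.mem_cons, not_or, forall_eq_or_imp,
      Multiset.sum_cons] at hcard hT hpos hr hbB h
    refine ⟨hab, hgb.1, ?_, ?_⟩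
    · refine hWin_singleton (T := T) ?_ ?_ ?_ ?_ ?_ hgb.of_cons
      · simpa using hcard
      · simp; omega
      · simp
      · simp; grind
      · rw [Multiset.count_cons_of_ne hab, Multiset.count_eq_zero.2 hbB.2]; simp
    · rcases h with ⟨h1, h2⟩ | ⟨h1, h2⟩
      · refine hWin_pair_of_red (T := T) ?_ ?_ hpos.2 h1.2 ⟨h2.1, ?_⟩
        · grind
        · omega
        · refine h2.2.imp_right (Or.imp_right ?_)
          rintro ⟨z, hz, hc⟩
          simp only [Multiset.mem_cons] at hz
          rcases hz with rfl | hz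
          · omega
          · exact ⟨z, hz, hc⟩
      · obtain ⟨C, rfl⟩ := Multiset.exists_cons_of_mem (h1.resolve_left (by omega))
        have hg : Good b T ((a + a + (a + a)) ::ₘ C) := by
          rw [Multiset.cons_swap] at hgb
          obtain ⟨h3, h4⟩ := hgb
          refine ⟨h3, h4.imp_right (Or.imp_right ?_)⟩
          rintro ⟨z, hz, hc⟩
          simp only [Multiset.mem_cons] at hz
          rcases hz with rfl | rfl | hz
          · exact ⟨_, Multiset.mem_cons_self _ _, by omega⟩
          · exact ⟨_, Multiset.mem_cons_self _ _, by omega⟩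
          · exact ⟨z, by simp [hz], hc⟩
        simp only [Multiset.card_cons, Multiset.mem_cons, not_or, forall_eq_or_imp,
          Multiset.sum_cons] at hcard hT hpos hbB
        exact hWin_pair_of_toBlue (by grind) (by omega) hpos.2.2 (by omega) hbB.2.2 h2 hg
  · rintro B' rfl
    simp at hbB

theorem hWin_triple_of_two {c : ℕ} {B : Multiset ℕ} (h : HLose {2, c} B) : HWin {1, 1, c} B :=
  h.hWin_of_hMove (HMove.red 1 1 {c} B)

theorem hWin_triple_of_succ {c : ℕ} {B : Multiset ℕ} (h : HLose {1, c + 1} B) :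
    HWin {1, 1, c} B := by
  have e : ({1, 1, c} : Multiset ℕ) = 1 ::ₘ c ::ₘ {1} :=
    congrArg (1 ::ₘ ·) (Multiset.pair_comm 1 c)
  have e' : ({1, c + 1} : Multiset ℕ) = (1 + c) ::ₘ {1} := by
    rw [Multiset.pair_comm, add_comm 1 c]; rfl
  rw [e]
  rw [e'] at h
  exact h.hWin_of_hMove (HMove.red 1 c {1} B)

theorem hWin_triple_of_toBlue {c : ℕ} {B : Multiset ℕ} (h : HLose {1, c} (2 ::ₘ B)) :
    HWin {1, 1, c} (1 ::ₘ B) :=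
  h.hWin_of_hMove (HMove.toBlue 1 {1, c} B)

theorem not_dvd_of_eq_sub {u T : ℕ} (hu : 1 ≤ u) (h : T = 2 * (2 * u + 1)) : ¬ 2 * u + 2 ∣ T := by
  intro hd
  have h2 : 2 * u + 2 ∣ 2 := by
    rw [← Nat.dvd_add_right hd]; exact ⟨2, by omega⟩
  have := Nat.le_of_dvd (by omega) h2
  omega

theorem not_dvd_of_eq_add {u T : ℕ} (hu : 1 ≤ u) (h : T = 2 * (2 * u + 3)) : ¬ 2 * u + 2 ∣ T := by
  intro hd
  have h2 : 2 * u + 2 ∣ 2 := by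
    rw [← Nat.dvd_add_right (show 2 * u + 2 ∣ 4 * u + 4 from ⟨2, by omega⟩)]
    convert hd using 1; omega
  have := Nat.le_of_dvd (by omega) h2
  omega

theorem not_dvd_of_eq_add_six {u T : ℕ} (hu : 1 ≤ u) (hu2 : u ≠ 2) (h : T = 2 * (2 * u + 5)) :
    ¬ 2 * u + 2 ∣ T := by
  intro hd
  have h2 : 2 * u + 2 ∣ 6 := by
    rw [← Nat.dvd_add_right (show 2 * u + 2 ∣ 4 * u + 4 from ⟨2, by omega⟩)]
    convert hd using 1; omega
  have := Nat.le_of_dvd (by omega) h2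
  obtain rfl : u = 1 := by omega
  omega

theorem hLose_two_odd {u T : ℕ} {B : Multiset ℕ} (hu : 1 ≤ u)
    (hcard : Even (Multiset.card B)) (hT : 2 * u + 3 + B.sum = T) (h0 : B ≠ 0)
    (hpos : ∀ x ∈ B, 0 < x) (h1 : 2 * u + 1 ∉ B) (h3 : 2 * u + 3 ∉ B) (hT3 : T ≠ 2 * (2 * u + 3))
    (h : 2 ∈ B → T ≠ 2 * (2 * u + 1) ∧ ((2 * u + 5 ∉ B ∧ T ≠ 2 * (2 * u + 5)) ∨ 4 ∈ B)) :
    HLose {2, 2 * u + 1} B := by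
  have e3 : 2 + (2 * u + 1) = 2 * u + 3 := by omega
  have e5 : 2 + 2 + (2 * u + 1) = 2 * u + 5 := by omega
  refine hLose_pair_of_notMem (T := T) (by omega) (by omega) hcard (by omega) h0 hpos
    (by rwa [e3]) (.of_odd (by omega) ⟨u + 1, by omega⟩) h1 (by omega)
    (fun hB => .of_odd (h hB).1.symm ⟨u, rfl⟩) (fun hB => (h hB).2.imp ?_ ?_)
  · rintro ⟨h5, hT5⟩
    rw [e5]
    exact ⟨h5, .of_odd hT5.symm ⟨u + 2, by omega⟩⟩
  · exact fun h4 => ⟨h4, by omega⟩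

theorem hWin_triple_of_hLose_one_odd {u T : ℕ} {B : Multiset ℕ} (hu : 1 ≤ u)
    (hcard : Odd (Multiset.card B)) (hT : 2 * u + 4 + B.sum = T)
    (hpos : ∀ x ∈ B, 0 < x) (h1 : 2 * u + 1 ∉ B) (h2 : 2 * u + 2 ∉ B) (hT1 : T ≠ 2 * (2 * u + 1))
    (h : Good (2 * u + 2) T (2 ::ₘ B)) : HWin {1, 1, 2 * u + 1} (1 ::ₘ B) := by
  have e2 : 1 + (2 * u + 1) = 2 * u + 2 := by omega
  refine hWin_triple_of_toBlue (hLose_pair_of_notMem (T := T) (by omega) (by omega) ?_ ?_ ?_ ?_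
    ?_ ?_ ?_ (by omega) (fun _ => .of_odd hT1.symm ⟨u, rfl⟩)
    (fun _ => .inr ⟨by simp, by omega⟩))
  · simpa using hcard.add_one
  · simp; omega
  · simp
  · simp; grind
  · rw [e2]; simp [h2]; omega
  · rwa [e2]
  · simp [h1]

theorem hWin_triple_of_hLose_one_even {u T : ℕ} {B : Multiset ℕ} (hu : 2 ≤ u)
    (hcard : Even (Multiset.card B)) (hT : 2 * u + 3 + B.sum = T)
    (hpos : ∀ x ∈ B, 0 < x) (h2 : 2 * u + 2 ∉ B) (h3 : 2 * u + 3 ∉ B) (hT3 : T ≠ 2 * (2 * u + 3))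
    (hB : 2 ∈ B) (h : Good (2 * u + 2) T B) : HWin {1, 1, 2 * u + 1} B := by
  have e3 : 1 + (2 * u + 1 + 1) = 2 * u + 3 := by omega
  refine hWin_triple_of_succ (hLose_pair_of_notMem (T := T) (by omega) (by omega) hcard (by omega)
    (by rintro rfl; simp at hB) hpos (by rwa [e3]) ?_ h2 (by omega) (fun _ => h)
    (fun _ => .inr ⟨hB, by omega⟩))
  rw [e3]
  exact .of_odd hT3.symm ⟨u + 1, by omega⟩

theorem HLose.hWin_of_blue {R B B₀ : Multiset ℕ} {x y : ℕ} (hl : HLose R ((x + y) ::ₘ B))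
    (h : B₀ = x ::ₘ y ::ₘ B) : HWin R B₀ := by
  subst h
  exact hl.hWin_of_hMove (HMove.blue x y R B)

theorem HLose.hWin_of_toRed {R B B₀ : Multiset ℕ} {x : ℕ} (hl : HLose ((x + x) ::ₘ R) B)
    (h : B₀ = x ::ₘ B) : HWin (x ::ₘ R) B₀ := by
  subst h
  exact hl.hWin_of_hMove (HMove.toRed x R B)

theorem hWin_one_one_five_of_twos : HWin {1, 1, 5} {1, 1, 1, 1, 1, 2, 2, 2} := by
  refine hWin_triple_of_succ (hLose_pair_of_cross (T := 18) (by omega) (by omega) (by decide)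
    (by decide) (by decide) (by decide) (by decide) (.of_odd (by decide) (by decide))
    ?_ ?_ ?_)
  · rintro x y B' h - - h6
    have : 5 + 1 ∈ ({1, 1, 1, 1, 1, 2, 2, 2} : Multiset ℕ) := by rw [h]; simp [h6]
    exact absurd this (by decide)
  · intro B' h
    obtain rfl := (Multiset.cons_inj_right 1).1 h
    refine ⟨by decide, by decide, ?_, ?_⟩
    · refine HLose.hWin_of_blue (x := 2) (y := 2) (B := {1, 1, 1, 1, 2, 2}) ?_ (by decide)
      exact hLose_singleton (T := 18) (by decide) (by decide) (by decide) (by decide)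
        (.of_mem (x := 4) (by decide) (by decide) (by decide))
    · exact hWin_pair_of_red (T := 18) (by decide) (by decide) (by decide) (by decide)
        (.of_not_dvd (by decide))
  · rintro B' h
    have : 5 + 1 ∈ ({1, 1, 1, 1, 1, 2, 2, 2} : Multiset ℕ) := by rw [h]; simp
    exact absurd this (by decide)

theorem hWin_one_one_five_of_three : HWin {1, 1, 5} {1, 1, 1, 1, 1, 1, 2, 3} := by
  refine hWin_triple_of_succ (hLose_pair_of_cross (T := 18) (by omega) (by omega) (by decide)
    (by decide) (by decide) (by decide) (by decide) (.of_odd (by decide) (by decide))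
    ?_ ?_ ?_)
  · rintro x y B' h - - h6
    have : 5 + 1 ∈ ({1, 1, 1, 1, 1, 1, 2, 3} : Multiset ℕ) := by rw [h]; simp [h6]
    exact absurd this (by decide)
  · intro B' h
    obtain rfl := (Multiset.cons_inj_right 1).1 h
    refine ⟨by decide, by decide, ?_, ?_⟩
    · refine HLose.hWin_of_blue (x := 2) (y := 3) (B := {1, 1, 1, 1, 1, 2}) ?_ (by decide)
      exact hLose_singleton (T := 18) (by decide) (by decide) (by decide) (by decide)
        (.of_mem (x := 5) (by decide) (by decide) (by decide))
    · exact hWin_pair_of_red (T := 18) (by decide) (by decide) (by decide) (by decide)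
        (.of_not_dvd (by decide))
  · rintro B' h
    have : 5 + 1 ∈ ({1, 1, 1, 1, 1, 1, 2, 3} : Multiset ℕ) := by rw [h]; simp
    exact absurd this (by decide)

theorem hWin_one_one_three_of_four : HWin {1, 1, 3} {1, 1, 1, 1, 3, 4} := by
  refine hWin_triple_of_succ (hLose_pair_of_cross (T := 16) (by omega) (by omega) (by decide)
    (by decide) (by decide) (by decide) (by decide) (.of_odd (by decide) (by decide))
    ?_ ?_ ?_)
  · intro x y B' h hxy h1 h4
    have hx : x ∈ ({1, 1, 1, 1, 3, 4} : Multiset ℕ) := by rw [h]; simp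
    have hy : y ∈ ({1, 1, 1, 1, 3, 4} : Multiset ℕ) := by rw [h]; simp
    have hc : Multiset.count 4 ({1, 1, 1, 1, 3, 4} : Multiset ℕ) = 1 := by decide
    have := Multiset.count_pos.2 h4
    rw [h] at hc
    simp only [Multiset.count_cons] at hc
    simp at hx hy
    grind
  · intro B' h
    obtain rfl := (Multiset.cons_inj_right 1).1 h
    refine ⟨by decide, by decide, ?_, ?_⟩
    · exact hWin_singleton (T := 16) (by decide) (by decide) (by decide) (by decide)
        (by decide) (.of_mem (x := 4) (by decide) (by decide) (by decide))
    · exact hWin_pair_of_red (T := 16) (by decide) (by decide) (by decide) (by decide)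
        (.of_not_dvd (by decide))
  · intro B' h
    rw [show ({1, 1, 1, 1, 3, 4} : Multiset ℕ) = 4 ::ₘ {1, 1, 1, 1, 3} by decide] at h
    obtain rfl := (Multiset.cons_inj_right _).1 h
    refine ⟨by decide, by decide, ?_, ?_⟩
    · refine HLose.hWin_of_toRed (x := 1) (R := 0) (B := {8, 1, 1, 1, 3}) ?_ (by decide)
      exact hLose_singleton (T := 16) (by decide) (by decide) (by decide) (by decide)
        (.of_mem (x := 8) (by decide) (by decide) (by decide))
    · exact hWin_pair_of_red (T := 16) (by decide) (by decide) (by decide) (by decide)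
        (.of_odd (by decide) (by decide))

theorem hWin_one_one_three {v j : ℕ} (hv : 1 ≤ v) (hvj : ¬ (v = 2 ∧ j = 1)) :
    HWin {1, 1, 3} (3 ::ₘ (2 * v) ::ₘ Multiset.replicate (2 * j + 2) 1) := by
  have hmem : ∀ x ∈ 3 ::ₘ (2 * v) ::ₘ Multiset.replicate (2 * j + 2) 1,
      x = 3 ∨ x = 2 * v ∨ x = 1 := by
    intro x hx
    simp only [Multiset.mem_cons, Multiset.mem_replicate] at hx
    tauto
  refine hWin_triple_of_two (hLose_pair_of_cross (T := 2 * v + 2 * j + 10) (by omega) (by omega)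
    (by simp; grind) (by simp; omega) (by simp) (fun x hx => by have := hmem x hx; omega)
    (fun hx => by have := hmem _ hx; omega) (.of_odd (by omega) (by decide)) ?_ ?_ ?_)
  · intro x y B' h hxy h2 h3
    have hx := hmem x (by rw [h]; simp)
    have hy := hmem y (by rw [h]; simp)
    have h2' := hmem 2 (by rw [h]; simp [h2])
    have hc : Multiset.count 3 (3 ::ₘ (2 * v) ::ₘ Multiset.replicate (2 * j + 2) 1) = 1 := by
      simp [Multiset.count_cons, Multiset.count_replicate]
      omega
    have := Multiset.count_pos.2 h3
    rw [h] at hc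
    simp only [Multiset.count_cons] at hc
    grind
  · intro B' h
    have hv1 : v = 1 := by
      have := hmem 2 (by rw [h]; simp)
      omega
    subst hv1
    rw [Multiset.cons_swap] at h
    obtain rfl := (Multiset.cons_inj_right _).1 h
    refine ⟨by omega, by omega, ?_, ?_⟩
    · refine hWin_singleton (T := 2 * j + 12) ?_ ?_ ?_ ?_ ?_ (.of_odd (by omega) (by decide))
      · simp; grind
      · simp; omega
      · simp
      · simp [Multiset.mem_replicate]
      · simp [Multiset.count_replicate]
    · by_cases hj : j = 1
      · subst hj
        rw [Multiset.pair_comm]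
        exact hWin_pair_of_toBlue (T := 14) (by decide) (by decide) (by decide) (by decide)
          (by decide) (by decide) (.of_not_dvd (by decide))
      · refine hWin_pair_of_red (T := 2 * j + 12) ?_ ?_ ?_ ?_ (.of_odd (by omega) (by decide))
        · simp; grind
        · simp; omega
        · simp [Multiset.mem_replicate]
        · simp [Multiset.mem_replicate]
  · intro B' h
    obtain rfl := (Multiset.cons_inj_right _).1 h
    refine ⟨by omega, by omega, ?_, ?_⟩
    · refine hWin_singleton (T := 2 * v + 2 * j + 10) ?_ ?_ ?_ ?_ ?_
        (.of_mem (x := 6) (by omega) (by simp) (by omega))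
      · simp; grind
      · simp; omega
      · simp
      · simp [Multiset.mem_replicate]; omega
      · simp [Multiset.count_cons, Multiset.count_replicate]; split <;> simp
    · by_cases hv1 : v = 1
      · subst hv1
        by_cases hj : j = 0
        · subst hj
          exact hWin_pair_of_red (T := 12) (by decide) (by decide) (by decide) (by decide)
            (.of_not_dvd (by decide))
        · rw [Multiset.pair_comm]
          refine hWin_pair_of_toBlue (T := 2 * j + 12) ?_ ?_ ?_ ?_ ?_ ?_
            (.of_mem (x := 4) (by omega) (by simp) (by omega))
          · simp; grind
          · simp; omega
          · simp [Multiset.mem_replicate]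
          · omega
          · simp [Multiset.mem_replicate]
          · omega
      by_cases hv3 : v = 3
      · subst hv3
        refine hWin_pair_of_toBlue (T := 2 * j + 16) ?_ ?_ ?_ ?_ ?_ ?_
          (.of_mem (x := 12) (by omega) (by simp) (by omega))
        · simp; grind
        · simp; omega
        · simp [Multiset.mem_replicate]
        · omega
        · simp [Multiset.mem_replicate]
        · omega
      refine HLose.hWin_of_blue (x := 2 * v) (y := 1) (B := Multiset.replicate (2 * j + 1) 1) ?_ rfl
      refine hLose_pair (T := 2 * v + 2 * j + 10) (by omega) (by omega) ?_ ?_ ?_ ?_ ?_ ?_ ?_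
        (.of_mem (x := 2 * v + 1) (by omega) (by simp) (by omega))
      · simp; grind
      · simp; omega
      · simp
      · simp [Multiset.mem_replicate]
      · simp [Multiset.mem_replicate]; omega
      · simp [Multiset.mem_replicate]
      · simp [Multiset.count_cons, Multiset.count_replicate]; split <;> omega

theorem not_dvd_of_three {u T : ℕ} (hT0 : 8 ≤ T)
    (h : T = 2 * (2 * u + 1) ∨ T = 2 * (2 * u + 3) ∨ T = 2 * (2 * u + 5)) : ¬ 2 * u + 4 ∣ T := by
  intro hd
  obtain ⟨c, hc⟩ := hd
  have h4 : (2 * u + 4) * c = 2 * u * c + 4 * c := by ring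
  have : c < 3 := by
    by_contra hc3
    have : (2 * u + 4) * 3 ≤ (2 * u + 4) * c := Nat.mul_le_mul_left _ (by omega)
    omega
  interval_cases c <;> omega

theorem hWin_two_odd {u v j : ℕ} (hu : 1 ≤ u) (hv : 1 ≤ v) :
    HWin {2, 2 * u + 1} (2 ::ₘ (2 * v) ::ₘ Multiset.replicate (2 * j + 3) 1) := by
  by_cases h : v + j + 1 = u
  · refine hWin_pair_of_toBlue (T := 2 * (u + v + j + 4)) ?_ ?_ ?_ ?_ ?_ ?_
      (.of_odd (by omega) ⟨u, rfl⟩) <;>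
    first | omega | (simp [Nat.even_iff, Multiset.mem_replicate]; omega)
  · refine hWin_pair_of_red (T := 2 * (u + v + j + 4)) ?_ ?_ ?_ ?_
      (.of_odd (by omega) ⟨u + 1, by omega⟩) <;>
    first | omega | (simp [Nat.odd_iff, Multiset.mem_replicate]; omega)

theorem hWin_one_even {u v j : ℕ} (hu : 1 ≤ u) (hv : 1 ≤ v) :
    HWin {1, 2 * u + 1 + 1} (2 ::ₘ (2 * v) ::ₘ Multiset.replicate (2 * j + 3) 1) := by
  by_cases h : v + j + 1 = u
  · rw [Multiset.replicate_succ, Multiset.cons_swap (2 * v), Multiset.cons_swap 2]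
    refine hWin_pair_of_toBlue (T := 2 * (u + v + j + 4)) ?_ ?_ ?_ ?_ ?_ ?_
      (.of_not_dvd (not_dvd_of_eq_add hu (by omega))) <;>
    first | omega | (simp [Nat.even_iff, Multiset.mem_replicate]; omega)
  · refine hWin_pair_of_red (T := 2 * (u + v + j + 4)) ?_ ?_ ?_ ?_
      (.of_odd (by omega) ⟨u + 1, by omega⟩) <;>
    first | omega | (simp [Nat.odd_iff, Multiset.mem_replicate]; omega)

theorem hWin_one_odd {u v j : ℕ} (hu : 1 ≤ u) (hv : 1 ≤ v) :
    HWin {1, 2 * u + 1} (2 ::ₘ 2 ::ₘ (2 * v) ::ₘ Multiset.replicate (2 * j + 2) 1) := by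
  by_cases h : v + j + 3 = u
  · have e2 : 1 + (2 * u + 1) = 2 * u + 2 := by omega
    refine hWin_pair_of_red (T := 2 * (u + v + j + 4)) ?_ ?_ ?_ ?_
      (.of_not_dvd (e2 ▸ not_dvd_of_eq_sub hu (by omega))) <;>
    first | omega | (simp [Nat.odd_iff, Multiset.mem_replicate]; omega)
  · rw [Multiset.replicate_succ, Multiset.cons_swap (2 * v), Multiset.cons_swap 2 1,
      Multiset.cons_swap 2 1]
    refine hWin_pair_of_toBlue (T := 2 * (u + v + j + 4)) ?_ ?_ ?_ ?_ ?_ ?_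
      (.of_odd (by omega) ⟨u, rfl⟩) <;>
    first | omega | (simp [Nat.even_iff, Multiset.mem_replicate]; omega)

theorem hLose_two_odd_of_twos {u v j : ℕ} (hu : 1 ≤ u) (hv : 1 ≤ v) (h1 : v + j + 3 ≠ u)
    (h3 : v + j + 1 ≠ u) (h5 : v + j ≠ u + 1) :
    HLose {2, 2 * u + 1} (2 ::ₘ 2 ::ₘ (2 * v) ::ₘ Multiset.replicate (2 * j + 1) 1) := by
  refine hLose_two_odd (T := 2 * (u + v + j + 4)) hu ?_ ?_ ?_ ?_ ?_ ?_ ?_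
      (fun _ => ⟨by omega, .inl ⟨?_, by omega⟩⟩) <;>
    first | omega | (simp [Nat.even_iff, Multiset.mem_replicate] <;> omega)

theorem hWin_two_one_odd {u v j : ℕ} (hu : 1 ≤ u) (hv : 1 ≤ v) :
    HWin {2, 1, 2 * u + 1} (2 ::ₘ (2 * v) ::ₘ Multiset.replicate (2 * j + 2) 1) := by
  by_cases h : v + j + 3 = u ∨ v + j + 1 = u ∨ v + j = u + 1
  · have e : 1 + 2 + (2 * u + 1) = 2 * u + 4 := by omega
    have hl : HLose {2 + 1, 2 * u + 1} (2 ::ₘ (2 * v) ::ₘ Multiset.replicate (2 * j + 2) 1) := by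
      refine hLose_pair (T := 2 * (u + v + j + 4)) (by omega) (by omega) ?_ ?_ ?_ ?_ ?_ ?_ ?_
        (.of_not_dvd (e ▸ not_dvd_of_three (by omega) (by omega)))
      on_goal 7 => rw [Multiset.count_eq_zero.2 (by simp [Multiset.mem_replicate]; omega)]
      all_goals first | omega | (simp [Nat.even_iff, Multiset.mem_replicate] <;> omega)
    exact hl.hWin_of_hMove (HMove.red 2 1 {2 * u + 1} _)
  · have e : ({2, 1, 2 * u + 1} : Multiset ℕ) = 1 ::ₘ {2, 2 * u + 1} := Multiset.cons_swap _ _ _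
    rw [Multiset.replicate_succ, Multiset.cons_swap (2 * v), Multiset.cons_swap 2, e]
    exact (hLose_two_odd_of_twos hu hv (by tauto) (by tauto) (by tauto)).hWin_of_hMove
      (HMove.toBlue 1 _ _)

theorem hWin_triple_of_twos {u v j : ℕ} (hu : 1 ≤ u) (hv : 1 ≤ v) :
    HWin {1, 1, 2 * u + 1} (2 ::ₘ 2 ::ₘ (2 * v) ::ₘ Multiset.replicate (2 * j + 1) 1) := by
  have e : 2 ::ₘ 2 ::ₘ (2 * v) ::ₘ Multiset.replicate (2 * j + 1) 1 =
      1 ::ₘ 2 ::ₘ 2 ::ₘ (2 * v) ::ₘ Multiset.replicate (2 * j) 1 := by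
    rw [Multiset.replicate_succ, Multiset.cons_swap (2 * v), Multiset.cons_swap 2 1,
      Multiset.cons_swap 2 1]
  have hodd (h1 : v + j + 3 ≠ u) (h2 : v ≠ u + 1)
      (h : Good (2 * u + 2) (2 * (u + v + j + 4))
        (2 ::ₘ 2 ::ₘ 2 ::ₘ (2 * v) ::ₘ Multiset.replicate (2 * j) 1)) :
      HWin {1, 1, 2 * u + 1} (2 ::ₘ 2 ::ₘ (2 * v) ::ₘ Multiset.replicate (2 * j + 1) 1) := by
    rw [e]
    refine hWin_triple_of_hLose_one_odd hu ?_ ?_ ?_ ?_ ?_ ?_ h <;>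
    first | omega | (simp [Nat.odd_iff, Multiset.mem_replicate] <;> omega)
  by_cases h1 : v + j + 3 = u
  · refine hWin_triple_of_hLose_one_even (T := 2 * (u + v + j + 4)) (by omega) ?_ ?_ ?_ ?_ ?_ ?_ ?_
      (.of_not_dvd (not_dvd_of_eq_sub hu (by omega))) <;>
    first | omega | (simp [Nat.even_iff, Multiset.mem_replicate] <;> omega)
  by_cases h3 : v + j + 1 = u
  · exact hodd h1 (by omega) (.of_not_dvd (not_dvd_of_eq_add hu (by omega)))
  by_cases h5 : v + j = u + 1
  · by_cases hj : j = 0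
    · subst hj
      obtain rfl : v = u + 1 := by omega
      rw [e]
      refine hWin_triple_of_toBlue (hLose_pair (T := 2 * (u + (u + 1) + 0 + 4)) (by omega)
        (by omega) ?_ ?_ ?_ ?_ ?_ ?_ ?_
        (.of_mem (x := 2 * (u + 1)) (by omega) (by simp) (by omega)))
      on_goal 7 =>
        rw [show 1 + (2 * u + 1) = 2 * (u + 1) by omega]
        simp [Multiset.count_cons]
        split <;> omega
      all_goals first | omega | (simp [Nat.even_iff] <;> omega)
    by_cases hu2 : u = 2
    · subst hu2
      by_cases hj1 : j = 1
      · obtain rfl : v = 2 := by omega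
        exact hodd h1 (by omega) (.of_mem (x := 2 * 2) (by omega) (by simp) (by omega))
      · obtain rfl : v = 1 := by omega
        obtain rfl : j = 2 := by omega
        convert hWin_one_one_five_of_twos using 1
        decide
    · exact hodd h1 (by omega) (.of_not_dvd (not_dvd_of_eq_add_six hu hu2 (by omega)))
  exact hWin_triple_of_two (hLose_two_odd_of_twos hu hv h1 h3 h5)

theorem hWin_triple_of_three {u v j : ℕ} (hu : 1 ≤ u) (hv : 1 ≤ v) :
    HWin {1, 1, 2 * u + 1} (3 ::ₘ (2 * v) ::ₘ Multiset.replicate (2 * j + 2) 1) := by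
  by_cases hu1 : u = 1
  · subst hu1
    by_cases hvj : v = 2 ∧ j = 1
    · obtain ⟨rfl, rfl⟩ := hvj
      convert hWin_one_one_three_of_four using 1
      decide
    · exact hWin_one_one_three hv hvj
  have hodd (h1 : v + j + 3 ≠ u) (h2 : v ≠ u + 1) (h : ¬ 2 * u + 2 ∣ 2 * (u + v + j + 4)) :
      HWin {1, 1, 2 * u + 1} (3 ::ₘ (2 * v) ::ₘ Multiset.replicate (2 * j + 2) 1) := by
    rw [Multiset.replicate_succ, Multiset.cons_swap (2 * v), Multiset.cons_swap 3]
    refine hWin_triple_of_hLose_one_odd hu ?_ ?_ ?_ ?_ ?_ ?_ (.of_not_dvd h) <;>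
    first | omega | (simp [Nat.odd_iff, Multiset.mem_replicate] <;> omega)
  by_cases h3 : v + j + 1 = u
  · exact hodd (by omega) (by omega) (not_dvd_of_eq_add hu (by omega))
  by_cases h1 : v = 1 ∧ v + j + 3 = u
  · refine hWin_triple_of_hLose_one_even (T := 2 * (u + v + j + 4)) (by omega) ?_ ?_ ?_ ?_ ?_ ?_ ?_
      (.of_not_dvd (not_dvd_of_eq_sub hu (by omega))) <;>
    first | omega | (simp [Nat.even_iff, Multiset.mem_replicate]; omega)
  by_cases h5 : v = 1 ∧ v + j = u + 1
  · obtain ⟨rfl, h5⟩ := h5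
    by_cases hu2 : u = 2
    · subst hu2
      obtain rfl : j = 2 := by omega
      convert hWin_one_one_five_of_three using 1
      decide
    · exact hodd (by omega) (by omega) (not_dvd_of_eq_add_six hu hu2 (by omega))
  refine hWin_triple_of_two (hLose_two_odd (T := 2 * (u + v + j + 4)) hu ?_ ?_ ?_ ?_ ?_ ?_ ?_
    (fun h2 => ?_))
  on_goal 8 =>
    have hv1 : v = 1 := by
      simp only [Multiset.mem_cons, Multiset.mem_replicate] at h2
      omega
    refine ⟨by omega, .inl ⟨?_, by omega⟩⟩
  all_goals first | omega | (simp [Nat.even_iff, Multiset.mem_replicate] <;> omega)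

theorem hWin_triple_of_two_odd {u v j : ℕ} (hu : 1 ≤ u) (hv : 1 ≤ v) :
    HWin {1, 1, 2 * u + 1} (2 ::ₘ (2 * v + 1) ::ₘ Multiset.replicate (2 * j + 2) 1) := by
  have heven (hu2 : 2 ≤ u) (h1 : v ≠ u + 1) (h3 : v + j + 1 ≠ u)
      (h : Good (2 * u + 2) (2 * (u + v + j + 4))
        (2 ::ₘ (2 * v + 1) ::ₘ Multiset.replicate (2 * j + 2) 1)) :
      HWin {1, 1, 2 * u + 1} (2 ::ₘ (2 * v + 1) ::ₘ Multiset.replicate (2 * j + 2) 1) := by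
    refine hWin_triple_of_hLose_one_even hu2 ?_ ?_ ?_ ?_ ?_ ?_ ?_ h <;>
    first | omega | (simp [Nat.even_iff, Multiset.mem_replicate] <;> omega)
  have hodd (h1 : v + j + 3 ≠ u) (h2 : v ≠ u)
      (h : Good (2 * u + 2) (2 * (u + v + j + 4))
        (2 ::ₘ 2 ::ₘ (2 * v + 1) ::ₘ Multiset.replicate (2 * j + 1) 1)) :
      HWin {1, 1, 2 * u + 1} (2 ::ₘ (2 * v + 1) ::ₘ Multiset.replicate (2 * j + 2) 1) := by
    rw [Multiset.replicate_succ, Multiset.cons_swap (2 * v + 1), Multiset.cons_swap 2]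
    refine hWin_triple_of_hLose_one_odd hu ?_ ?_ ?_ ?_ ?_ ?_ h <;>
    first | omega | (simp [Nat.odd_iff, Multiset.mem_replicate] <;> omega)
  rcases lt_trichotomy u v with huv | rfl | huv
  · exact hodd (by omega) (by omega) (.of_mem (x := 2 * v + 1) (by omega) (by simp) (by omega))
  · by_cases hu1 : u = 1
    · subst hu1
      rw [Multiset.cons_swap]
      exact hWin_one_one_three hv (by omega)
    · exact heven (by omega) (by omega) (by omega)
        (.of_mem (x := 2 * u + 1) (by omega) (by simp) (by omega))
  · by_cases h1 : v + j + 3 = u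
    · exact heven (by omega) (by omega) (by omega) (.of_not_dvd (not_dvd_of_eq_sub hu (by omega)))
    by_cases h3 : v + j + 1 = u
    · exact hodd (by omega) (by omega) (.of_not_dvd (not_dvd_of_eq_add hu (by omega)))
    by_cases h5 : v + j = u + 1
    · by_cases hu2 : u = 2
      · subst hu2
        obtain rfl : v = 1 := by omega
        obtain rfl : j = 2 := by omega
        convert hWin_one_one_five_of_three using 1
        decide
      · exact hodd (by omega) (by omega) (.of_not_dvd (not_dvd_of_eq_add_six hu hu2 (by omega)))
    refine hWin_triple_of_two (hLose_two_odd (T := 2 * (u + v + j + 4)) hu ?_ ?_ ?_ ?_ ?_ ?_ ?_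
      (fun _ => ⟨by omega, .inl ⟨?_, by omega⟩⟩)) <;>
    first | omega | (simp [Nat.even_iff, Multiset.mem_replicate] <;> omega)

theorem hWin_triple_of_even {u v j : ℕ} (hu : 1 ≤ u) (hv : 1 ≤ v) :
    HWin {1, 1, 2 * u + 1} ((2 + 2 * v) ::ₘ Multiset.replicate (2 * j + 3) 1) := by
  by_cases h3 : v + j + 1 = u
  · rw [Multiset.replicate_succ, Multiset.cons_swap]
    refine hWin_triple_of_hLose_one_odd (T := 2 * (u + v + j + 4)) hu ?_ ?_ ?_ ?_ ?_ ?_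
      (.of_not_dvd (not_dvd_of_eq_add hu (by omega))) <;>
    first | omega | (simp [Nat.odd_iff, Multiset.mem_replicate] <;> omega)
  · refine hWin_triple_of_two (hLose_two_odd (T := 2 * (u + v + j + 4)) hu ?_ ?_ ?_ ?_ ?_ ?_ ?_
      (fun h2 => absurd h2 ?_)) <;>
    first | omega | (simp [Nat.even_iff, Multiset.mem_replicate] <;> omega)

theorem cons_add_eq_of_eq_cons_cons {a b n x y : ℕ} {B : Multiset ℕ}
    (h : a ::ₘ b ::ₘ Multiset.replicate (n + 2) 1 = x ::ₘ y ::ₘ B) :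
    (x + y) ::ₘ B = (a + b) ::ₘ Multiset.replicate (n + 2) 1 ∨
    (x + y) ::ₘ B = (a + 1) ::ₘ b ::ₘ Multiset.replicate (n + 1) 1 ∨
    (x + y) ::ₘ B = a ::ₘ (b + 1) ::ₘ Multiset.replicate (n + 1) 1 ∨
    (x + y) ::ₘ B = 2 ::ₘ a ::ₘ b ::ₘ Multiset.replicate n 1 := by
  have hx : x = a ∨ x = b ∨ x = 1 := by
    have : x ∈ a ::ₘ b ::ₘ Multiset.replicate (n + 2) 1 := by rw [h]; simp
    simp only [Multiset.mem_cons, Multiset.mem_replicate] at this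
    tauto
  rcases hx with rfl | rfl | rfl
  · rw [Multiset.cons_inj_right] at h
    have hy : y = b ∨ y = 1 := by
      have : y ∈ b ::ₘ Multiset.replicate (n + 2) 1 := by rw [h]; simp
      simp only [Multiset.mem_cons, Multiset.mem_replicate] at this
      tauto
    rcases hy with rfl | rfl
    · rw [Multiset.cons_inj_right] at h
      exact .inl (by rw [h])
    · rw [Multiset.replicate_succ, Multiset.cons_swap, Multiset.cons_inj_right] at h
      exact .inr (.inl (by rw [h]))
  · rw [Multiset.cons_swap, Multiset.cons_inj_right] at h
    have hy : y = a ∨ y = 1 := by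
      have : y ∈ a ::ₘ Multiset.replicate (n + 2) 1 := by rw [h]; simp
      simp only [Multiset.mem_cons, Multiset.mem_replicate] at this
      tauto
    rcases hy with rfl | rfl
    · rw [Multiset.cons_inj_right] at h
      exact .inl (by rw [h, add_comm])
    · rw [Multiset.replicate_succ, Multiset.cons_swap, Multiset.cons_inj_right] at h
      exact .inr (.inr (.inl (by rw [← h, Multiset.cons_swap])))
  · rw [Multiset.replicate_succ, Multiset.cons_swap b, Multiset.cons_swap a,
      Multiset.cons_inj_right] at h
    have hy : y = a ∨ y = b ∨ y = 1 := by
      have : y ∈ a ::ₘ b ::ₘ Multiset.replicate (n + 1) 1 := by rw [h]; simp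
      simp only [Multiset.mem_cons, Multiset.mem_replicate] at this
      tauto
    rcases hy with rfl | rfl | rfl
    · rw [Multiset.cons_inj_right] at h
      exact .inr (.inl (by rw [h, add_comm]))
    · rw [Multiset.cons_swap, Multiset.cons_inj_right] at h
      exact .inr (.inr (.inl (by rw [← h, Multiset.cons_swap, add_comm])))
    · rw [Multiset.replicate_succ, Multiset.cons_swap b, Multiset.cons_swap a,
        Multiset.cons_inj_right] at h
      exact .inr (.inr (.inr (by rw [h])))

theorem hLose_triple_of_forall {c : ℕ} {B : Multiset ℕ} (hc : c ∉ B)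
    (h2 : HWin {2, c} B) (h1 : HWin {1, c + 1} B)
    (hblue : ∀ x y B', B = x ::ₘ y ::ₘ B' → HWin {1, 1, c} ((x + y) ::ₘ B'))
    (htoRed : ∀ B', B = 1 ::ₘ B' → HWin {2, 1, c} B')
    (htoBlue : ∀ B', B = 1 ::ₘ B' → HWin {1, c} (2 ::ₘ B')) : HLose {1, 1, c} B := by
  have key {x : ℕ} {R B' : Multiset ℕ} (hR : ({1, 1, c} : Multiset ℕ) = x ::ₘ R)
      (hB : B = x ::ₘ B') : x = 1 ∧ R = {1, c} := by
    have hx : x = 1 ∨ x = c := by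
      have : x ∈ ({1, 1, c} : Multiset ℕ) := by rw [hR]; simp
      simpa using this
    rcases hx with rfl | rfl
    · exact ⟨rfl, ((Multiset.cons_inj_right 1).1 hR).symm⟩
    · simp [hB] at hc
  refine HLose.of_forall ?_
  generalize hR : ({1, 1, c} : Multiset ℕ) = R
  rintro R' B' (⟨x, y, R, _⟩ | ⟨x, y, _, B'⟩ | ⟨x, R, B'⟩ | ⟨x, R, B'⟩)
  · have hx : x = 1 ∨ x = c := by
      have : x ∈ ({1, 1, c} : Multiset ℕ) := by rw [hR]; simp
      simpa using this
    rcases hx with rfl | rfl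
    · replace hR : ({1, c} : Multiset ℕ) = y ::ₘ R := (Multiset.cons_inj_right 1).1 hR
      have hy : y = 1 ∨ y = c := by
        have : y ∈ ({1, c} : Multiset ℕ) := by rw [hR]; simp
        simpa using this
      rcases hy with rfl | rfl
      · obtain rfl : {c} = R := (Multiset.cons_inj_right 1).1 hR
        exact h2
      · rw [Multiset.pair_comm] at hR
        obtain rfl : {1} = R := (Multiset.cons_inj_right _).1 hR
        rwa [Multiset.pair_comm, add_comm] at h1
    · have e : ({1, 1, x} : Multiset ℕ) = x ::ₘ {1, 1} :=
        (congrArg (1 ::ₘ ·) (Multiset.pair_comm 1 x)).trans (Multiset.cons_swap 1 x {1})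
      rw [e, Multiset.cons_inj_right] at hR
      have hy : y = 1 := by
        have : y ∈ ({1, 1} : Multiset ℕ) := by rw [hR]; simp
        simpa using this
      subst hy
      obtain rfl : {1} = R := (Multiset.cons_inj_right 1).1 hR
      rwa [Multiset.pair_comm] at h1
  · subst hR
    exact hblue x y B' rfl
  · obtain ⟨rfl, rfl⟩ := key hR rfl
    exact htoRed B' rfl
  · obtain ⟨rfl, rfl⟩ := key hR rfl
    exact htoBlue B' rfl

theorem hLose_triple {u v j : ℕ} (hu : 1 ≤ u) (hv : 1 ≤ v) :
    HLose {1, 1, 2 * u + 1} (2 ::ₘ (2 * v) ::ₘ Multiset.replicate (2 * j + 3) 1) := by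
  have e {B : Multiset ℕ}
      (h : 2 ::ₘ (2 * v) ::ₘ Multiset.replicate (2 * j + 3) 1 = 1 ::ₘ B) :
      2 ::ₘ (2 * v) ::ₘ Multiset.replicate (2 * j + 2) 1 = B := by
    rwa [Multiset.replicate_succ, Multiset.cons_swap (2 * v), Multiset.cons_swap 2,
      Multiset.cons_inj_right] at h
  refine hLose_triple_of_forall ?_ (hWin_two_odd hu hv) (hWin_one_even hu hv) ?_ ?_ ?_
  · simp [Multiset.mem_replicate]
    omega
  · intro x y B' h
    rcases cons_add_eq_of_eq_cons_cons (n := 2 * j + 1) h with h | h | h | h <;> rw [h]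
    · exact hWin_triple_of_even hu hv
    · exact hWin_triple_of_three hu hv
    · exact hWin_triple_of_two_odd hu hv
    · exact hWin_triple_of_twos hu hv
  · rintro B' h
    rw [← e h]
    exact hWin_two_one_odd hu hv
  · rintro B' h
    rw [← e h]
    exact hWin_one_odd hu hv

theorem heights_add (c : Bool) (P Q : Position) : heights c (P + Q) = heights c P + heights c Q := by
  simp [heights]

theorem heights_replicate_self (c : Bool) (n : ℕ) :
    heights c (Multiset.replicate n [c]) = Multiset.replicate n 1 := by
  induction n with
  | zero => simp [heights]
  | succ n ih => rw [Multiset.replicate_succ, heights_cons_self rfl, ih]; rfl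

theorem heights_replicate_ne {c d : Bool} (h : d ≠ c) (n : ℕ) :
    heights c (Multiset.replicate n [d]) = 0 := by
  induction n with
  | zero => simp [heights]
  | succ n ih => rw [Multiset.replicate_succ, heights_cons_ne (by simpa using h), ih]

/-- Every position `⟨3, k; 2u+1; 2v⟩` with `k ≥ 4` even and `u, v ≥ 1` is a
first-player win. -/
theorem position_one (k u v : ℕ) (R B : Stack)
    (hk : 4 ≤ k) (hkeven : Even k)
    (hu : 1 ≤ u) (hv : 1 ≤ v)
    (hR : R.head? = some true) (hRlen : R.length = 2 * u + 1)
    (hB : B.head? = some false) (hBlen : B.length = 2 * v) :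
    FirstWin (R ::ₘ B ::ₘ
      (Multiset.replicate 3 [true] + Multiset.replicate k [false])) := by
  obtain ⟨j, rfl⟩ : ∃ j, k = 2 * j + 4 := by
    obtain ⟨m, rfl⟩ := hkeven
    exact ⟨m - 2, by omega⟩
  have hw : HWin (1 ::ₘ {1, 1, 2 * u + 1})
      (1 ::ₘ (2 * v) ::ₘ Multiset.replicate (2 * j + 3) 1) :=
    (hLose_triple hu hv).hWin_of_hMove (HMove.toBlue 1 _ _)
  have hBR : B.head? ≠ some true := by simp [hB]
  have hRB : R.head? ≠ some false := by simp [hR]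
  refine hw _ ?_ ?_ ?_
  · intro s hs
    rintro rfl
    simp only [Multiset.mem_cons, Multiset.mem_add, Multiset.mem_replicate] at hs
    rcases hs with rfl | rfl | ⟨-, h⟩ | ⟨-, h⟩
    · simp at hR
    · simp at hB
    · cases h
    · cases h
  · rw [heights_cons_self hR, heights_cons_ne hBR, hRlen, heights_add, heights_replicate_self,
      heights_replicate_ne (by decide), add_zero]
    exact (Multiset.cons_swap _ 1 {1, 1}).trans (congrArg (1 ::ₘ ·)
      ((Multiset.cons_swap _ 1 {1}).trans (congrArg (1 ::ₘ ·) (Multiset.pair_comm _ _))))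
  · rw [heights_cons_ne hRB, heights_cons_self hB, hBlen, heights_add, heights_replicate_self,
      heights_replicate_ne (by decide), zero_add, Multiset.replicate_succ, Multiset.cons_swap]
end
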